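/- arXiv:math/0508474 — 4 statements merged into one kernel-verified Lean document; each statement's English description precedes it below -/
import Mathlib

section
/- Let P = (z;t) ∈ S(O,1) with t > 0, let R > 1, and write N_R = (0,0,R²/π) ∈ S(O,R). (i) If λ(P) < R then dist(P, S(O,R)) > R − 1. (ii) If λ(P) ≤ R then d(P, N_R) = dist(P, S(O,R)) and N_R is the only point of S(O,R) realizing this distance. (iii) If λ(P) > R then dist(P, S(O,R)) = R − 1 and this distance is realized by some point of S(O,R) different from N_R. -/
noncomputable section

open MeasureTheory

/-- Points of the Heisenberg group `ℍ`, identified with `ℝ³ ≅ ℂ × ℝ`: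
`(x, y, t)` corresponds to `(z ; t)` with `z = x + iy`. -/
abbrev H : Type := ℝ × ℝ × ℝ

/-- The Heisenberg group law
`(x,y,t)·(x',y',t') = (x+x', y+y', t+t'+2(x'y − xy'))`. -/
def Hmul (p q : H) : H :=
  (p.1 + q.1, p.2.1 + q.2.1, p.2.2 + q.2.2 + 2 * (q.1 * p.2.1 - p.1 * q.2.1))

/-- The Heisenberg group inverse. -/
def Hinv (p : H) : H := (-p.1, -p.2.1, -p.2.2)

/-- The identity `O = (0,0,0)`. -/
def HO : H := (0, 0, 0)

/-- The control (Carnot–Carathéodory) distance: the infimum of the lengths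
`∫₀¹ √(a(s)² + b(s)²) ds` of horizontal Lipschitz curves `γ` joining `P` to `Q`,
i.e. curves satisfying a.e. `γ' = a·X(γ) + b·Y(γ)` where `X = ∂ₓ + 2y∂_t` and
`Y = ∂_y − 2x∂_t`. -/
def dH (P Q : H) : ℝ :=
  sInf { L : ℝ | ∃ (γ : ℝ → H) (a b : ℝ → ℝ) (K : NNReal),
    LipschitzWith K γ ∧ γ 0 = P ∧ γ 1 = Q ∧
    (∀ᵐ s ∂volume, s ∈ Set.Icc (0:ℝ) 1 →
      HasDerivAt γ (a s, b s, 2 * (γ s).2.1 * a s - 2 * (γ s).1 * b s) s) ∧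
    IntervalIntegrable (fun s => Real.sqrt (a s ^ 2 + b s ^ 2)) volume 0 1 ∧
    L = ∫ s in (0:ℝ)..1, Real.sqrt (a s ^ 2 + b s ^ 2) }

/-- `γ : ℝ → ℍ` is a `(1+ε)`-quasigeodesic. -/
def IsQuasiGeodesic (ε : ℝ) (γ : ℝ → H) : Prop :=
  ∀ s s' : ℝ, (1 + ε)⁻¹ * |s - s'| ≤ dH (γ s) (γ s') ∧
    dH (γ s) (γ s') ≤ (1 + ε) * |s - s'|

/-- `f : ℍ → ℍ` is `(1+ε)`-biLipschitz for the control distance. -/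
def IsBiLip (ε : ℝ) (f : H → H) : Prop :=
  ∀ P Q : H, (1 + ε)⁻¹ * dH P Q ≤ dH (f P) (f Q) ∧ dH (f P) (f Q) ≤ (1 + ε) * dH P Q

/-- `(a,b)` is the horizontal speed of `γ`: a.e. `γ'(s) = a(s)X(γ(s)) + b(s)Y(γ(s))`. -/
def HasHorizSpeed (γ : ℝ → H) (a b : ℝ → ℝ) : Prop :=
  ∀ᵐ s ∂volume, HasDerivAt γ (a s, b s, 2 * (γ s).2.1 * a s - 2 * (γ s).1 * b s) s

/-- The unit-speed geodesic `γ_{φ,α}` from the origin (a straight line when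
`φ = 0`). -/
def geo (φ α s : ℝ) : H :=
  if φ = 0 then (Real.cos α * s, Real.sin α * s, 0)
  else (Real.sin α * (1 - Real.cos (φ * s)) / φ + Real.cos α * Real.sin (φ * s) / φ,
        Real.sin α * Real.sin (φ * s) / φ - Real.cos α * (1 - Real.cos (φ * s)) / φ,
        2 * (φ * s - Real.sin (φ * s)) / φ ^ 2)

/-- `l` is the `λ`-coordinate of `P`: there is a length-minimizing unit-speed
geodesic `γ_{φ,α}` from `O` through `P` (i.e. `γ_{φ,α}(d(O,P)) = P` with
`|φ|·d(O,P) ≤ 2π`, so that `γ_{φ,α}` is minimizing up to `P`), with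
`l = 2π/(|φ|·d(O,P))`, the total lifetime of `γ_{φ,α}` divided by `d(O,P)`. -/
def IsLambdaCoord (P : H) (l : ℝ) : Prop :=
  ∃ φ α : ℝ, φ ≠ 0 ∧ |φ| * dH HO P ≤ 2 * Real.pi ∧
    geo φ α (dH HO P) = P ∧ l = 2 * Real.pi / (|φ| * dH HO P)

/-- The distance from `P` to the sphere `S(O,R)`. -/
def sphereDist (P : H) (R : ℝ) : ℝ :=
  sInf { d : ℝ | ∃ Q : H, dH HO Q = R ∧ d = dH P Q }

/-- The north pole `N_R = (0; R²/π)` of the sphere `S(O,R)`. -/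
def northPole (R : ℝ) : H := (0, 0, R ^ 2 / Real.pi)



def mm (k s : ℝ) : ℝ := if k = 0 then s else Real.sin (k * s) / k

def tau (k s : ℝ) : ℝ :=
  if k = 0 then 0 else s / k - Real.sin (k * s) * Real.cos (k * s) / k ^ 2

def cc (k s : ℝ) : ℝ := Real.cos (k * s) / mm k s

def FF (k s : ℝ) (p : H) : ℝ := cc k s * (p.1 ^ 2 + p.2.1 ^ 2) + k * p.2.2

lemma geo_eq (k α s : ℝ) : geo (2 * k) α s =
    (mm k s * Real.cos (α - k * s), mm k s * Real.sin (α - k * s), tau k s) := by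
  unfold geo mm tau
  by_cases hk : k = 0
  · subst hk
    simp [mul_comm]
  · have h2 : 2 * k ≠ 0 := by simpa using hk
    simp only [hk, h2, if_false]
    have e : 2 * k * s = 2 * (k * s) := by ring
    rw [e, Real.sin_two_mul, Real.cos_two_mul, Real.cos_sub, Real.sin_sub]
    have := Real.sin_sq_add_cos_sq (k * s)
    set S := Real.sin (k * s)
    set C := Real.cos (k * s)
    have hC : C ^ 2 = 1 - S ^ 2 := by linarith
    refine Prod.ext ?_ (Prod.ext ?_ ?_)
    · simp only [hC]; field_simp; ring
    · simp only [hC]; field_simp; ring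
    · simp only; field_simp

lemma mm_neg (k s : ℝ) : mm (-k) s = mm k s := by
  unfold mm; by_cases hk : k = 0 <;> simp [hk]

lemma tau_neg (k s : ℝ) : tau (-k) s = - tau k s := by
  unfold tau; by_cases hk : k = 0
  · simp [hk]
  · simp [hk, div_neg]; ring

lemma cc_neg (k s : ℝ) : cc (-k) s = cc k s := by
  unfold cc; rw [mm_neg]; simp

lemma mm_pos {k s : ℝ} (hs : 0 < s) (h : |k| * s < Real.pi) : 0 < mm k s := by
  wlog hk : 0 ≤ k with H
  · rw [← mm_neg]; exact H hs (by simpa using h) (by linarith)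
  unfold mm
  rcases hk.eq_or_lt with rfl | hk
  · simpa using hs
  · rw [abs_of_pos hk] at h
    simp only [hk.ne', if_false]
    exact div_pos (Real.sin_pos_of_pos_of_lt_pi (by positivity) h) hk

lemma mm_mem {k s : ℝ} (hs : 0 ≤ s) (h : |k| * s ≤ Real.pi) : 0 ≤ mm k s := by
  wlog hk : 0 ≤ k with H
  · rw [← mm_neg]; exact H hs (by simpa using h) (by linarith)
  unfold mm
  rcases hk.eq_or_lt with rfl | hk
  · simpa using hs
  · rw [abs_of_pos hk] at h
    simp only [hk.ne', if_false]
    exact div_nonneg (Real.sin_nonneg_of_nonneg_of_le_pi (by positivity) h) hk.le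

lemma mm_lt {k s : ℝ} (hk0 : k ≠ 0) (hs : 0 < s) : mm k s < s := by
  wlog hk : 0 < k with H
  · rw [← mm_neg]
    exact H (by simpa using hk0) hs (lt_of_le_of_ne (by linarith) (by simpa using hk0))
  unfold mm
  simp only [hk.ne', if_false]
  rw [div_lt_iff₀ hk, mul_comm s]
  exact Real.sin_lt (by positivity)

lemma hasDerivAt_mm (k s : ℝ) : HasDerivAt (mm k) (Real.cos (k * s)) s := by
  unfold mm
  by_cases hk : k = 0
  · simp only [hk, if_true]; simpa using hasDerivAt_id' s
  · simp only [hk, if_false]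
    have := (((hasDerivAt_id' s).const_mul k).sin).div_const k
    refine HasDerivAt.congr_deriv this ?_
    rw [mul_one, mul_div_assoc, div_self hk, mul_one]

lemma hasDerivAt_cc (k s : ℝ) (h : mm k s ≠ 0) :
    HasDerivAt (cc k) (-(cc k s ^ 2 + k ^ 2)) s := by
  have h1 := (((hasDerivAt_id s).const_mul k).cos).div (hasDerivAt_mm k s) h
  have e : k * mm k s = Real.sin (k * s) := by
    unfold mm; by_cases hk : k = 0
    · simp [hk]
    · simp only [hk, if_false]; field_simp
  refine HasDerivAt.congr_deriv h1 ?_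
  simp only [id, cc]
  rw [← e]
  field_simp
  ring

lemma hasDerivAt_geo (k α s : ℝ) : HasDerivAt (geo (2 * k) α)
    (Real.cos (α - 2 * k * s), Real.sin (α - 2 * k * s),
      2 * (geo (2 * k) α s).2.1 * Real.cos (α - 2 * k * s)
        - 2 * (geo (2 * k) α s).1 * Real.sin (α - 2 * k * s)) s := by
  by_cases hk : k = 0
  · subst hk
    have : geo (2 * 0) α = fun s => (Real.cos α * s, Real.sin α * s, (0:ℝ)) := by
      funext s; simp [geo]
    rw [this]
    refine HasDerivAt.prodMk ?_ (HasDerivAt.prodMk ?_ ?_)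
    · simpa using (hasDerivAt_id s).const_mul (Real.cos α)
    · simpa using (hasDerivAt_id s).const_mul (Real.sin α)
    · refine HasDerivAt.congr_deriv (hasDerivAt_const s (0:ℝ)) ?_
      simp; ring
  · have h2 : 2 * k ≠ 0 := by simpa using hk
    have hg : geo (2 * k) α = fun s => (Real.sin α * (1 - Real.cos (2 * k * s)) / (2 * k) + Real.cos α * Real.sin (2 * k * s) / (2 * k),
        Real.sin α * Real.sin (2 * k * s) / (2 * k) - Real.cos α * (1 - Real.cos (2 * k * s)) / (2 * k),
        2 * (2 * k * s - Real.sin (2 * k * s)) / (2 * k) ^ 2) := by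
      funext s; simp only [geo, h2, if_false]
    rw [hg]
    have hl : HasDerivAt (fun s => 2 * k * s) (2 * k) s := by
      simpa using (hasDerivAt_id s).const_mul (2 * k)
    have hc := hl.cos
    have hs := hl.sin
    have key := Real.sin_sq_add_cos_sq (2 * k * s)
    have key2 := Real.sin_sq_add_cos_sq α
    rw [Real.cos_sub, Real.sin_sub]
    refine HasDerivAt.prodMk ?_ (HasDerivAt.prodMk ?_ ?_)
    · refine HasDerivAt.congr_deriv (((hc.const_sub 1).const_mul _ |>.div_const _).add ((hs.const_mul _).div_const _)) ?_
      field_simp; ring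
    · refine HasDerivAt.congr_deriv (((hs).const_mul _ |>.div_const _).sub (((hc.const_sub 1).const_mul _).div_const _)) ?_
      field_simp
    · refine HasDerivAt.congr_deriv (((hl.sub hs).const_mul 2).div_const _) ?_
      simp only
      set S := Real.sin (2 * k * s)
      set C := Real.cos (2 * k * s)
      set a := Real.sin α
      set b := Real.cos α
      field_simp
      have hb : b ^ 2 = 1 - a ^ 2 := by linarith
      have hC : C ^ 2 = 1 - S ^ 2 := by linarith
      ring_nf
      simp only [hb, hC]
      ring

lemma Hmul_assoc (p q r : H) : Hmul (Hmul p q) r = Hmul p (Hmul q r) := by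
  unfold Hmul; refine Prod.ext ?_ (Prod.ext ?_ ?_) <;> simp only <;> ring

lemma Hinv_mul (p : H) : Hmul (Hinv p) p = HO := by
  unfold Hmul Hinv HO; refine Prod.ext ?_ (Prod.ext ?_ ?_) <;> simp only <;> ring

lemma mul_Hinv (p : H) : Hmul p (Hinv p) = HO := by
  unfold Hmul Hinv HO; refine Prod.ext ?_ (Prod.ext ?_ ?_) <;> simp only <;> ring

lemma HO_mul (p : H) : Hmul HO p = p := by
  unfold Hmul HO; refine Prod.ext ?_ (Prod.ext ?_ ?_) <;> simp

lemma mul_HO (p : H) : Hmul p HO = p := by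
  unfold Hmul HO; refine Prod.ext ?_ (Prod.ext ?_ ?_) <;> simp

lemma Hmul_right_cancel {p q r : H} (h : Hmul p r = Hmul q r) : p = q := by
  have := congrArg (fun x => Hmul x (Hinv r)) h
  simpa [Hmul_assoc, mul_Hinv, mul_HO] using this

lemma geo_add (k α s s' : ℝ) :
    Hmul (geo (2 * k) α s) (geo (2 * k) (α - 2 * k * s) s') = geo (2 * k) α (s + s') := by
  by_cases hk : k = 0
  · subst hk
    unfold Hmul geo
    refine Prod.ext ?_ (Prod.ext ?_ ?_) <;> simp <;> ring
  · have h2 : 2 * k ≠ 0 := by simpa using hk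
    unfold Hmul geo
    simp only [h2, if_false]
    rw [mul_add (2 * k), Real.sin_add, Real.cos_add, Real.sin_sub, Real.cos_sub]
    have key := Real.sin_sq_add_cos_sq (2 * k * s)
    have key1 := Real.sin_sq_add_cos_sq (2 * k * s')
    have key2 := Real.sin_sq_add_cos_sq α
    set S := Real.sin (2 * k * s)
    set C := Real.cos (2 * k * s)
    set S' := Real.sin (2 * k * s')
    set C' := Real.cos (2 * k * s')
    set a := Real.sin α
    set b := Real.cos α
    have hb : b ^ 2 = 1 - a ^ 2 := by linarith
    have hC : C ^ 2 = 1 - S ^ 2 := by linarith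
    refine Prod.ext ?_ (Prod.ext ?_ ?_)
    · simp only; field_simp; ring
    · simp only; field_simp; ring
    · simp only; field_simp; ring_nf; simp only [hb, hC]; ring

lemma FF_geo {k α s : ℝ} (h : mm k s ≠ 0) : FF k s (geo (2 * k) α s) = s := by
  rw [geo_eq]
  unfold FF cc
  simp only
  have : (mm k s * Real.cos (α - k * s)) ^ 2 + (mm k s * Real.sin (α - k * s)) ^ 2 = mm k s ^ 2 := by
    have := Real.sin_sq_add_cos_sq (α - k * s)
    linear_combination (mm k s ^ 2) * this
  rw [this]
  have : Real.cos (k * s) / mm k s * mm k s ^ 2 = Real.cos (k * s) * mm k s := by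
    field_simp
  rw [this]
  unfold mm tau
  by_cases hk : k = 0
  · simp [hk]
  · simp only [hk, if_false]; field_simp; ring

lemma rr_geo (k α s : ℝ) : (geo (2 * k) α s).1 ^ 2 + (geo (2 * k) α s).2.1 ^ 2 = mm k s ^ 2 := by
  rw [geo_eq]
  have := Real.sin_sq_add_cos_sq (α - k * s)
  simp only
  linear_combination (mm k s ^ 2) * this

/-- for `σ < s` the calibration exceeds `σ` -/
lemma FF_geo_gt {k α s σ : ℝ} (hσ : 0 < σ) (hs : σ < s) (h : |k| * s ≤ Real.pi) :
    σ < FF k σ (geo (2 * k) α s) := by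
  unfold FF
  rw [rr_geo, geo_eq]
  simp only
  wlog hk : 0 ≤ k with H
  · have := H (α := α) hσ hs (k := -k) (by simpa using h) (by linarith)
    rw [cc_neg, mm_neg, tau_neg] at this
    linarith
  rcases hk.eq_or_lt with rfl | hk
  · simp only [cc, mm, tau]
    simp
    rw [inv_mul_eq_div, lt_div_iff₀ hσ]
    nlinarith
  · rw [abs_of_pos hk] at h
    have hlt : k * σ < k * s := by gcongr
    have hx : 0 < Real.sin (k * σ) := Real.sin_pos_of_pos_of_lt_pi (by positivity) (by linarith)
    have hy : 0 ≤ Real.sin (k * s) := Real.sin_nonneg_of_nonneg_of_le_pi (by nlinarith) h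
    have hxy : 0 ≤ Real.sin (k * s - k * σ) :=
      Real.sin_nonneg_of_nonneg_of_le_pi (by linarith) (by nlinarith [mul_pos hk hσ])
    have e : cc k σ * mm k s ^ 2 + k * tau k s - σ =
        (Real.sin (k * s) * Real.sin (k * s - k * σ) / Real.sin (k * σ) + (k * s - k * σ)) / k := by
      simp only [cc, mm, tau, hk.ne', if_false]
      rw [Real.sin_sub]
      field_simp
      ring
    have : 0 < (Real.sin (k * s) * Real.sin (k * s - k * σ) / Real.sin (k * σ) + (k * s - k * σ)) / k := by
      apply div_pos _ hk
      have := div_nonneg (mul_nonneg hy hxy) hx.le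
      linarith
    linarith



def Adm (P Q : H) (L : ℝ) : Prop := ∃ (γ : ℝ → H) (a b : ℝ → ℝ) (K : NNReal),
    LipschitzWith K γ ∧ γ 0 = P ∧ γ 1 = Q ∧
    (∀ᵐ s ∂volume, s ∈ Set.Icc (0:ℝ) 1 →
      HasDerivAt γ (a s, b s, 2 * (γ s).2.1 * a s - 2 * (γ s).1 * b s) s) ∧
    IntervalIntegrable (fun s => Real.sqrt (a s ^ 2 + b s ^ 2)) volume 0 1 ∧
    L = ∫ s in (0:ℝ)..1, Real.sqrt (a s ^ 2 + b s ^ 2)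

lemma dH_eq (P Q : H) : dH P Q = sInf {L | Adm P Q L} := rfl

lemma ac_comp {f σ : ℝ → ℝ} {K : NNReal} {S : Set ℝ} {a b : ℝ} (hf : LipschitzOnWith K f S)
    (hm : Set.MapsTo σ (Set.uIcc a b) S) (h : AbsolutelyContinuousOnInterval σ a b) :
    AbsolutelyContinuousOnInterval (fun x => f (σ x)) a b := by
  rw [absolutelyContinuousOnInterval_iff] at h ⊢
  intro ε hε
  obtain ⟨δ, hδ, H⟩ := h (ε / (K + 1)) (by positivity)
  refine ⟨δ, hδ, fun E hE hE2 => ?_⟩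
  have h1 := H E hE hE2
  calc _ ≤ ∑ i ∈ Finset.range E.1, K * dist (σ (E.2 i).1) (σ (E.2 i).2) := by
        apply Finset.sum_le_sum
        intro i hi
        exact hf.dist_le_mul _ (hm (hE.left i hi).left) _ (hm (hE.left i hi).right)
    _ = K * ∑ i ∈ Finset.range E.1, dist (σ (E.2 i).1) (σ (E.2 i).2) := by
        rw [Finset.mul_sum]
    _ ≤ K * (ε / (K + 1)) := by gcongr
    _ < (K + 1) * (ε / (K + 1)) := by gcongr; linarith
    _ = ε := by field

lemma Adm.nonneg {P Q : H} {L : ℝ} (h : Adm P Q L) : 0 ≤ L := by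
  obtain ⟨γ, a, b, K, -, -, -, -, -, rfl⟩ := h
  exact intervalIntegral.integral_nonneg (by norm_num) (fun _ _ => Real.sqrt_nonneg _)

lemma dH_nonneg (P Q : H) : 0 ≤ dH P Q := Real.sInf_nonneg (fun _ h => Adm.nonneg h)

lemma dH_le {P Q : H} {L : ℝ} (h : Adm P Q L) : dH P Q ≤ L :=
  csInf_le ⟨0, fun _ h => Adm.nonneg h⟩ h

lemma cc_contDiff {k u v : ℝ} (hu : 0 < u) (h : |k| * v < Real.pi) :
    ∃ K, LipschitzOnWith K (cc k) (Set.Icc u v) := by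
  have hpos : ∀ s ∈ Set.Icc u v, mm k s ≠ 0 := fun s hs =>
    (mm_pos (by linarith [hs.1]) (lt_of_le_of_lt (by gcongr; exact hs.2) h)).ne'
  have hm : ContDiff ℝ 1 (mm k) := by
    unfold mm
    by_cases hk : k = 0
    · simp only [hk, if_true]; fun_prop
    · simp only [hk, if_false]; fun_prop
  have : ContDiffOn ℝ 1 (cc k) (Set.Icc u v) := by
    unfold cc
    apply ContDiffOn.div
    · fun_prop
    · exact hm.contDiffOn
    · exact hpos
  exact this.exists_lipschitzOnWith (by decide) (convex_Icc _ _) isCompact_Icc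

/-- the calibration inequality along curves -/
lemma calib_adm {P Q : H} {L k σ₀ : ℝ} (h : Adm P Q L) (h0 : 0 < σ₀)
    (hk : |k| * (σ₀ + L) < Real.pi) : FF k (σ₀ + L) Q ≤ L + FF k σ₀ P := by
  have hL := h.nonneg
  obtain ⟨γ, a, b, K, hγ, rfl, rfl, hd, hi, hLe⟩ := h
  set ρ : ℝ → ℝ := fun s => Real.sqrt (a s ^ 2 + b s ^ 2) with hρ
  set σ : ℝ → ℝ := fun s => σ₀ + ∫ u in (0:ℝ)..s, ρ u with hσ
  have hσ0 : σ 0 = σ₀ := by simp [hσ]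
  have hσ1 : σ 1 = σ₀ + L := by rw [hLe]
  have h01 : Set.uIcc (0:ℝ) 1 = Set.Icc 0 1 := Set.uIcc_of_le zero_le_one
  have hint : ∀ s ∈ Set.Icc (0:ℝ) 1, IntervalIntegrable ρ volume 0 s := fun s hs =>
    hi.mono_set (by rw [h01, Set.uIcc_of_le hs.1]; exact Set.Icc_subset_Icc_right hs.2)
  have hmem : Set.MapsTo σ (Set.uIcc 0 1) (Set.Icc σ₀ (σ₀ + L)) := by
    intro s hs
    rw [h01] at hs
    have h1 : 0 ≤ ∫ u in (0:ℝ)..s, ρ u :=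
      intervalIntegral.integral_nonneg hs.1 (fun _ _ => Real.sqrt_nonneg _)
    have h2 : 0 ≤ ∫ u in s..1, ρ u :=
      intervalIntegral.integral_nonneg hs.2 (fun _ _ => Real.sqrt_nonneg _)
    have h3 : (∫ u in (0:ℝ)..s, ρ u) + ∫ u in s..1, ρ u = L := by
      rw [hLe]
      exact intervalIntegral.integral_add_adjacent_intervals (hint s hs) ((hint s hs).symm.trans hi)
    constructor <;> simp only [hσ] <;> linarith
  have hacσ : AbsolutelyContinuousOnInterval σ 0 1 := by
    have h1 := hi.absolutelyContinuousOnInterval_intervalIntegral (c := 0) (by simp)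
    have h2 : AbsolutelyContinuousOnInterval (fun _ : ℝ => σ₀) 0 1 :=
      (LipschitzWith.const σ₀).lipschitzOnWith.absolutelyContinuousOnInterval
    exact h2.add h1
  obtain ⟨K', hK'⟩ := cc_contDiff h0 hk
  have hacc := ac_comp hK' hmem hacσ
  have hx : AbsolutelyContinuousOnInterval (fun s => (γ s).1) 0 1 :=
    (LipschitzWith.prod_fst.comp hγ).lipschitzOnWith.absolutelyContinuousOnInterval
  have hy : AbsolutelyContinuousOnInterval (fun s => (γ s).2.1) 0 1 :=
    (LipschitzWith.prod_fst.comp (LipschitzWith.prod_snd.comp hγ)).lipschitzOnWith.absolutelyContinuousOnInterval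
  have ht : AbsolutelyContinuousOnInterval (fun s => (γ s).2.2) 0 1 :=
    (LipschitzWith.prod_snd.comp (LipschitzWith.prod_snd.comp hγ)).lipschitzOnWith.absolutelyContinuousOnInterval
  set g : ℝ → ℝ := fun s => FF k (σ s) (γ s) - σ s with hg
  have hgac : AbsolutelyContinuousOnInterval g 0 1 := by
    have := ((hacc.mul ((hx.mul hx).add (hy.mul hy))).add (ht.const_mul k)).sub hacσ
    have e : g = (((fun x => cc k (σ x)) * (((fun s => (γ s).1) * fun s => (γ s).1)
        + (fun s => (γ s).2.1) * fun s => (γ s).2.1) + fun x => k * (γ x).2.2) - σ) := by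
      funext s
      simp only [hg, FF, Pi.add_apply, Pi.mul_apply, Pi.sub_apply]
      ring
    rw [e]
    exact this
  have hgd : ∀ᵐ s ∂volume, s ∈ Set.Icc (0:ℝ) 1 → deriv g s ≤ 0 := by
    filter_upwards [hd, hi.ae_hasDerivAt_integral] with s h1 h2 hs
    have h1 := h1 hs
    have h2 : HasDerivAt σ (ρ s) s :=
      ((h2 (by rwa [h01])) 0 (by simp)).const_add σ₀
    have hm := hmem (by rwa [h01] : s ∈ Set.uIcc (0:ℝ) 1)
    have hne : mm k (σ s) ≠ 0 :=
      (mm_pos (by linarith [hm.1]) (lt_of_le_of_lt (by gcongr; exact hm.2) hk)).ne'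
    have hc := (hasDerivAt_cc k (σ s) hne).comp s h2
    have dx : HasDerivAt (fun s => (γ s).1) (a s) s := h1.fst
    have dy : HasDerivAt (fun s => (γ s).2.1) (b s) s := h1.snd.fst
    have dt : HasDerivAt (fun s => (γ s).2.2) (2 * (γ s).2.1 * a s - 2 * (γ s).1 * b s) s := h1.snd.snd
    have hG : HasDerivAt g _ s :=
      ((hc.mul ((dx.pow 2).add (dy.pow 2))).add (dt.const_mul k)).sub h2
    rw [hG.deriv]
    simp only [Function.comp, Pi.add_apply, Pi.pow_apply, Nat.cast_ofNat]
    have hr0 : 0 ≤ ρ s := Real.sqrt_nonneg _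
    have hr2 : ρ s ^ 2 = a s ^ 2 + b s ^ 2 := Real.sq_sqrt (by positivity)
    set c := cc k (σ s)
    set x := (γ s).1
    set y := (γ s).2.1
    rcases hr0.eq_or_lt with hr | hr
    · have hz : a s ^ 2 + b s ^ 2 = 0 := by rw [← hr2, ← hr]; ring
      have ha : a s = 0 := by nlinarith [sq_nonneg (a s), sq_nonneg (b s)]
      have hb : b s = 0 := by nlinarith [sq_nonneg (a s), sq_nonneg (b s)]
      rw [ha, hb, ← hr]; simp
    · have key : ρ s * (-(c ^ 2 + k ^ 2) * ρ s * (x ^ 2 + y ^ 2) + c * (2 * x ^ (2 - 1) * a s + 2 * y ^ (2 - 1) * b s) + k * (2 * y * a s - 2 * x * b s) - ρ s)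
        = - ((a s - ρ s * (c * x + k * y)) ^ 2 + (b s - ρ s * (c * y - k * x)) ^ 2) := by
        norm_num
        linear_combination (-1) * hr2
      by_contra hcon
      push Not at hcon
      have := mul_pos hr hcon
      rw [key] at this
      nlinarith [sq_nonneg (a s - ρ s * (c * x + k * y)), sq_nonneg (b s - ρ s * (c * y - k * x))]
  have hfin := hgac.integral_deriv_eq_sub
  have hle : ∫ s in (0:ℝ)..1, deriv g s ≤ 0 := by
    rw [intervalIntegral.integral_of_le zero_le_one]
    apply integral_nonpos_of_ae
    rw [Filter.EventuallyLE, ae_restrict_iff' measurableSet_Ioc]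
    filter_upwards [hgd] with s hs hm using hs ⟨hm.1.le, hm.2⟩
  rw [hfin] at hle
  simp only [hg, hσ0, hσ1] at hle
  linarith



def trA (g : H) : H →L[ℝ] H :=
  (ContinuousLinearMap.fst ℝ ℝ (ℝ × ℝ)).prod
    (((ContinuousLinearMap.fst ℝ ℝ ℝ).comp (ContinuousLinearMap.snd ℝ ℝ (ℝ × ℝ))).prod
      ((ContinuousLinearMap.snd ℝ ℝ ℝ).comp (ContinuousLinearMap.snd ℝ ℝ (ℝ × ℝ))
        + (2 * g.2.1) • (ContinuousLinearMap.fst ℝ ℝ (ℝ × ℝ))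
        - (2 * g.1) • ((ContinuousLinearMap.fst ℝ ℝ ℝ).comp (ContinuousLinearMap.snd ℝ ℝ (ℝ × ℝ)))))

lemma trA_apply (g p : H) : trA g p = (p.1, p.2.1, p.2.2 + 2 * g.2.1 * p.1 - 2 * g.1 * p.2.1) := by
  simp [trA]

lemma Hmul_eq (g p : H) : Hmul g p = g + trA g p := by
  rw [trA_apply]
  unfold Hmul
  refine Prod.ext ?_ (Prod.ext ?_ ?_) <;> simp
  ring

lemma Adm.trans {P Q : H} {L : ℝ} (g : H) (h : Adm P Q L) : Adm (Hmul g P) (Hmul g Q) L := by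
  obtain ⟨γ, a, b, K, hγ, rfl, rfl, hd, hi, hL⟩ := h
  refine ⟨fun s => Hmul g (γ s), a, b, 0 + ‖trA g‖₊ * K, ?_, rfl, rfl, ?_, hi, hL⟩
  · simp only [Hmul_eq]
    exact (LipschitzWith.const g).add ((trA g).lipschitz.comp hγ)
  · filter_upwards [hd] with s hs hm
    have h1 := ((trA g).hasFDerivAt.comp_hasDerivAt s (hs hm)).const_add g
    simp only [Hmul_eq]
    refine HasDerivAt.congr_deriv h1 ?_
    rw [trA_apply, trA_apply]
    refine Prod.ext rfl (Prod.ext rfl ?_)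
    simp
    ring

lemma Hinv_mul_cancel (g p : H) : Hmul (Hinv g) (Hmul g p) = p := by
  rw [← Hmul_assoc, Hinv_mul, HO_mul]

lemma mul_Hinv_cancel (g p : H) : Hmul g (Hmul (Hinv g) p) = p := by
  rw [← Hmul_assoc, mul_Hinv, HO_mul]

lemma dH_trans (g P Q : H) : dH (Hmul g P) (Hmul g Q) = dH P Q := by
  rw [dH_eq, dH_eq]
  congr 1
  ext L
  refine ⟨fun h => ?_, fun h => h.trans g⟩
  have := Adm.trans (Hinv g) h
  rwa [Hinv_mul_cancel, Hinv_mul_cancel] at this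

lemma dH_N (P Q : H) : dH P Q = dH HO (Hmul (Hinv P) Q) := by
  rw [← dH_trans (Hinv P), Hinv_mul]

lemma geo_zero (k α : ℝ) : geo (2 * k) α 0 = HO := by
  rw [geo_eq]; simp [mm, tau, HO]

lemma adm_geo_O (k α s : ℝ) (hs : 0 ≤ s) : Adm HO (geo (2 * k) α s) s := by
  have hder : ∀ u : ℝ, HasDerivAt (fun u => geo (2 * k) α (s * u))
      (s * Real.cos (α - 2 * k * (s * u)), s * Real.sin (α - 2 * k * (s * u)),
        2 * (geo (2 * k) α (s * u)).2.1 * (s * Real.cos (α - 2 * k * (s * u)))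
        - 2 * (geo (2 * k) α (s * u)).1 * (s * Real.sin (α - 2 * k * (s * u)))) u := by
    intro u
    have h1 : HasDerivAt (fun u : ℝ => s * u) s u := by
      simpa using (hasDerivAt_id' u).const_mul s
    have := (hasDerivAt_geo k α (s * u)).scomp u h1
    refine HasDerivAt.congr_deriv this ?_
    refine Prod.ext rfl (Prod.ext rfl ?_)
    simp
    ring
  have hsq : ∀ u : ℝ, Real.sqrt ((s * Real.cos (α - 2 * k * (s * u))) ^ 2 +
      (s * Real.sin (α - 2 * k * (s * u))) ^ 2) = s := by
    intro u
    have : (s * Real.cos (α - 2 * k * (s * u))) ^ 2 + (s * Real.sin (α - 2 * k * (s * u))) ^ 2 = s ^ 2 := by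
      linear_combination s ^ 2 * Real.sin_sq_add_cos_sq (α - 2 * k * (s * u))
    rw [this, Real.sqrt_sq hs]
  refine ⟨fun u => geo (2 * k) α (s * u), fun u => s * Real.cos (α - 2 * k * (s * u)),
    fun u => s * Real.sin (α - 2 * k * (s * u)), (s + s * (2 / |k|)).toNNReal, ?_, ?_, ?_, ?_, ?_, ?_⟩
  · apply lipschitzWith_of_nnnorm_deriv_le (fun u => (hder u).differentiableAt)
    intro u
    rw [(hder u).deriv, ← NNReal.coe_le_coe, coe_nnnorm, Real.coe_toNNReal _ (by positivity)]
    have hp : 0 ≤ s * (2 / |k|) := by positivity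
    have hc : |Real.cos (α - 2 * k * (s * u))| ≤ 1 := Real.abs_cos_le_one _
    have hsn : |Real.sin (α - 2 * k * (s * u))| ≤ 1 := Real.abs_sin_le_one _
    rw [norm_prod_le_iff, norm_prod_le_iff]
    simp only [Real.norm_eq_abs]
    refine ⟨?_, ?_, ?_⟩
    · rw [abs_mul, abs_of_nonneg hs]; nlinarith
    · rw [abs_mul, abs_of_nonneg hs]; nlinarith
    · have e : 2 * (geo (2 * k) α (s * u)).2.1 * (s * Real.cos (α - 2 * k * (s * u)))
        - 2 * (geo (2 * k) α (s * u)).1 * (s * Real.sin (α - 2 * k * (s * u)))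
        = s * (2 * mm k (s * u) * Real.sin (k * (s * u))) := by
        rw [geo_eq]
        have : k * (s * u) = (α - k * (s * u)) - (α - 2 * k * (s * u)) := by ring
        conv_rhs => rw [this, Real.sin_sub]
        simp only
        ring
      rw [e, abs_mul, abs_of_nonneg hs]
      have : |2 * mm k (s * u) * Real.sin (k * (s * u))| ≤ 2 / |k| := by
        unfold mm
        by_cases hk : k = 0
        · simp [hk]
        · simp only [hk, if_false]
          have hkp : 0 < |k| := abs_pos.mpr hk
          have h1 := Real.abs_sin_le_one (k * (s * u))
          have h0 := abs_nonneg (Real.sin (k * (s * u)))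
          rw [abs_mul, abs_mul, abs_div, le_div_iff₀ hkp]
          rw [show |(2:ℝ)| = 2 from by norm_num]
          have : 2 * (|Real.sin (k * (s * u))| / |k|) * |Real.sin (k * (s * u))| * |k| =
            2 * (|Real.sin (k * (s * u))| * |Real.sin (k * (s * u))|) := by field_simp
          rw [this]
          nlinarith
      nlinarith
  · simp [geo_zero]
  · simp
  · exact Filter.Eventually.of_forall (fun u _ => hder u)
  · simp only [hsq]; exact intervalIntegrable_const
  · simp only [hsq]; simp

lemma dH_geo_le (P : H) (k α s : ℝ) (hs : 0 ≤ s) : dH P (Hmul P (geo (2 * k) α s)) ≤ s := by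
  have := Adm.trans P (adm_geo_O k α s hs)
  rw [mul_HO] at this
  exact dH_le this

lemma geo_surj (p : H) : ∃ k α s : ℝ, 0 ≤ s ∧ |k| * s ≤ Real.pi ∧ geo (2 * k) α s = p := by
  -- reduce to t ≥ 0
  suffices h : ∀ x y t : ℝ, 0 ≤ t → ∃ k α s : ℝ, 0 ≤ s ∧ |k| * s ≤ Real.pi ∧
      mm k s * Real.cos α = x ∧ mm k s * Real.sin α = y ∧ tau k s = t by
    obtain ⟨x, y, t⟩ := p
    rcases le_total 0 t with ht | ht
    · obtain ⟨k, α, s, h1, h2, h3, h4, h5⟩ := h x y t ht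
      refine ⟨k, α + k * s, s, h1, h2, ?_⟩
      rw [geo_eq]; simp [h3, h4, h5]
    · obtain ⟨k, α, s, h1, h2, h3, h4, h5⟩ := h x y (-t) (by linarith)
      refine ⟨-k, α + (-k) * s, s, h1, by simpa using h2, ?_⟩
      rw [geo_eq, mm_neg, tau_neg]; simp [h3, h4, h5]
  intro x y t ht
  set r := Real.sqrt (x ^ 2 + y ^ 2) with hr
  have hr0 : 0 ≤ r := Real.sqrt_nonneg _
  have hr2 : r ^ 2 = x ^ 2 + y ^ 2 := Real.sq_sqrt (by positivity)
  have hpi := Real.pi_pos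
  rcases hr0.eq_or_lt with h0 | hrp
  · have hz : x ^ 2 + y ^ 2 = 0 := by rw [← hr2, ← h0]; ring
    have hx : x = 0 := by nlinarith [sq_nonneg x, sq_nonneg y]
    have hy : y = 0 := by nlinarith [sq_nonneg x, sq_nonneg y]
    subst hx; subst hy
    rcases ht.eq_or_lt with h0 | htp
    · exact ⟨0, 0, 0, le_rfl, by simp [hpi.le], by simp [mm], by simp [mm], by simp [tau, h0]⟩
    · set s := Real.sqrt (Real.pi * t) with hs
      have hsp : 0 < s := Real.sqrt_pos.mpr (by positivity)
      have hs2 : s ^ 2 = Real.pi * t := Real.sq_sqrt (by positivity)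
      have e : Real.pi / s * s = Real.pi := by field_simp
      have hne : Real.pi / s ≠ 0 := by positivity
      refine ⟨Real.pi / s, 0, s, hsp.le, ?_, ?_, ?_, ?_⟩
      · rw [abs_of_pos (by positivity), e]
      · simp [mm, hne, e]
      · simp
      · simp only [tau, hne, if_false, e, Real.sin_pi]
        field_simp
        rw [hs2]; ring
  · obtain ⟨α, hα1, hα2⟩ : ∃ α : ℝ, r * Real.cos α = x ∧ r * Real.sin α = y := by
      have hz : ‖(⟨x, y⟩ : ℂ)‖ = r := by
        rw [Complex.norm_def, Complex.normSq_mk, hr]; congr 1; ring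
      refine ⟨Complex.arg ⟨x, y⟩, ?_, ?_⟩
      · rw [← hz, Complex.norm_mul_cos_arg]
      · rw [← hz, Complex.norm_mul_sin_arg]
    rcases ht.eq_or_lt with h0 | htp
    · exact ⟨0, α, r, hr0, by simp [hpi.le], by simp [mm, hα1], by simp [mm, hα2], by simp [tau, h0]⟩
    · set G : ℝ → ℝ := fun u => t * Real.sin u ^ 2 - r ^ 2 * (u - Real.sin u * Real.cos u) with hG
      set u0 := min (t / r ^ 2) 1 with hu0
      have hu0p : 0 < u0 := lt_min (by positivity) one_pos
      have hu01 : u0 ≤ 1 := min_le_right _ _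
      have hpi3 := Real.pi_gt_three
      have hsin0 : 0 < Real.sin u0 := Real.sin_pos_of_pos_of_lt_pi hu0p (by linarith)
      have hcos0 : 0 < Real.cos u0 := Real.cos_pos_of_mem_Ioo ⟨by linarith, by linarith⟩
      have hGu0 : 0 ≤ G u0 := by
        have h1 : u0 * Real.cos u0 ≤ Real.sin u0 := by
          have := Real.lt_tan hu0p (by linarith)
          rw [Real.tan_eq_sin_div_cos, lt_div_iff₀ hcos0] at this
          exact this.le
        have h2 : u0 - Real.sin u0 * Real.cos u0 ≤ u0 * Real.sin u0 ^ 2 := by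
          have := Real.sin_sq_add_cos_sq u0
          have h3 : u0 * Real.cos u0 * Real.cos u0 ≤ Real.sin u0 * Real.cos u0 := by gcongr
          nlinarith
        have h3 : r ^ 2 * u0 ≤ t := by
          have := min_le_left (t / r ^ 2) 1
          rw [← hu0, le_div_iff₀ (by positivity)] at this
          linarith
        simp only [hG]
        have h4 : r ^ 2 * (u0 - Real.sin u0 * Real.cos u0) ≤ r ^ 2 * (u0 * Real.sin u0 ^ 2) := by gcongr
        have h5 : r ^ 2 * u0 * Real.sin u0 ^ 2 ≤ t * Real.sin u0 ^ 2 := by gcongr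
        linarith
      have hGpi : G Real.pi < 0 := by
        simp only [hG, Real.sin_pi]
        have : 0 < r ^ 2 * Real.pi := by positivity
        nlinarith
      have hcont : ContinuousOn G (Set.Icc u0 Real.pi) := by
        apply Continuous.continuousOn; simp only [hG]; fun_prop
      obtain ⟨u, hu, hGu⟩ := intermediate_value_Icc' (by linarith) hcont ⟨hGpi.le, hGu0⟩
      have hulp : u < Real.pi := by
        refine lt_of_le_of_ne hu.2 ?_
        rintro rfl
        linarith
      have hup : 0 < u := by linarith [hu.1]
      have hsu : 0 < Real.sin u := Real.sin_pos_of_pos_of_lt_pi hup hulp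
      have hkp : 0 < Real.sin u / r := by positivity
      have e : Real.sin u / r * (r * u / Real.sin u) = u := by field_simp
      have hm : mm (Real.sin u / r) (r * u / Real.sin u) = r := by
        simp only [mm, hkp.ne', if_false, e]; field_simp
      refine ⟨Real.sin u / r, α, r * u / Real.sin u, by positivity, ?_, ?_, ?_, ?_⟩
      · rw [abs_of_pos hkp, e]; exact hulp.le
      · rw [hm, hα1]
      · rw [hm, hα2]
      · simp only [tau, hkp.ne', if_false, e]
        simp only [hG] at hGu
        field_simp
        linarith

lemma adm_exists (P Q : H) : ∃ L, Adm P Q L := by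
  obtain ⟨k, α, s, hs, -, h⟩ := geo_surj (Hmul (Hinv P) Q)
  refine ⟨s, ?_⟩
  have := Adm.trans P (adm_geo_O k α s hs)
  rwa [mul_HO, h, mul_Hinv_cancel] at this

lemma cc_continuousAt {k s : ℝ} (h : mm k s ≠ 0) : ContinuousAt (cc k) s :=
  (hasDerivAt_cc k s h).continuousAt

lemma calib {P Q : H} {k σ₀ : ℝ} (h0 : 0 < σ₀)
    (hk : |k| * (σ₀ + dH P Q) < Real.pi) :
    FF k (σ₀ + dH P Q) Q ≤ dH P Q + FF k σ₀ P := by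
  obtain ⟨u, -, hu, hmem⟩ := exists_seq_tendsto_sInf (S := {L | Adm P Q L}) (adm_exists P Q)
    ⟨0, fun _ h => Adm.nonneg h⟩
  rw [← dH_eq] at hu
  have hd := dH_nonneg P Q
  have hne : mm k (σ₀ + dH P Q) ≠ 0 := (mm_pos (by linarith) hk).ne'
  have h1 : Filter.Tendsto (fun n => σ₀ + u n) Filter.atTop (nhds (σ₀ + dH P Q)) := hu.const_add _
  have h2 : Filter.Tendsto (fun n => FF k (σ₀ + u n) Q) Filter.atTop (nhds (FF k (σ₀ + dH P Q) Q)) := by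
    unfold FF
    exact (((cc_continuousAt hne).tendsto.comp h1).mul_const _).add_const _
  have h3 : Filter.Tendsto (fun n => u n + FF k σ₀ P) Filter.atTop (nhds (dH P Q + FF k σ₀ P)) :=
    hu.add_const _
  refine le_of_tendsto_of_tendsto h2 h3 ?_
  have h4 : ∀ᶠ n in Filter.atTop, |k| * (σ₀ + u n) < Real.pi :=
    (h1.const_mul |k|).eventually_lt_const hk
  filter_upwards [h4] with n hn
  exact calib_adm (hmem n) h0 hn

lemma FF_O (k s : ℝ) : FF k s HO = 0 := by simp [FF, HO]

lemma calib_O_lt {p : H} {k σ : ℝ} (h0 : dH HO p < σ) (hk : |k| * σ < Real.pi) :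
    FF k σ p ≤ dH HO p := by
  have := calib (P := HO) (Q := p) (k := k) (σ₀ := σ - dH HO p) (by linarith) (by simpa using hk)
  rw [FF_O] at this
  simpa using this

lemma calib_O {p : H} {k σ : ℝ} (hσ : 0 < σ) (h0 : dH HO p ≤ σ) (hk : |k| * σ < Real.pi) :
    FF k σ p ≤ dH HO p := by
  have hne : mm k σ ≠ 0 := (mm_pos hσ hk).ne'
  have hc : Filter.Tendsto (fun s => FF k s p) (nhdsWithin σ (Set.Ioi σ)) (nhds (FF k σ p)) := by
    unfold FF
    exact (((cc_continuousAt hne).tendsto.mono_left nhdsWithin_le_nhds).mul_const _).add_const _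
  refine le_of_tendsto hc ?_
  have h4 : ∀ᶠ s in nhdsWithin σ (Set.Ioi σ), |k| * s < Real.pi := by
    apply nhdsWithin_le_nhds
    exact (((continuous_const.mul continuous_id).tendsto σ : Filter.Tendsto (fun s => |k| * s) _ _)).eventually_lt_const hk
  filter_upwards [h4, self_mem_nhdsWithin] with s hs hs2
  exact calib_O_lt (lt_of_le_of_lt h0 hs2) hs

lemma dH_O_geo {k α s : ℝ} (hs : 0 ≤ s) (h : |k| * s ≤ Real.pi) : dH HO (geo (2 * k) α s) = s := by
  apply le_antisymm
  · exact dH_le (adm_geo_O k α s hs)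
  · by_contra hc
    push Not at hc
    set d := dH HO (geo (2 * k) α s)
    have hd : 0 ≤ d := dH_nonneg _ _
    obtain ⟨σ, h1, h2⟩ := exists_between hc
    have h3 := FF_geo_gt (α := α) (by linarith : 0 < σ) h2 h
    have h4 : |k| * σ < Real.pi := by
      rcases (abs_nonneg k).eq_or_lt with hk | hk
      · rw [← hk]; simpa using Real.pi_pos
      · nlinarith
    have := calib_O_lt h1 h4
    linarith

lemma triangle_O (P Q : H) : dH HO Q ≤ dH HO P + dH P Q := by
  obtain ⟨k, α, s, hs, hk, rfl⟩ := geo_surj Q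
  rw [dH_O_geo hs hk]
  by_contra hc
  push Not at hc
  set d := dH P (geo (2 * k) α s) with hd
  have hd0 : 0 ≤ d := dH_nonneg _ _
  have hP := dH_nonneg HO P
  obtain ⟨σ, h1, h2⟩ := exists_between hc
  have h4 : |k| * σ < Real.pi := by
    rcases (abs_nonneg k).eq_or_lt with hk | hk
    · rw [← hk]; simpa using Real.pi_pos
    · nlinarith
  have h3 := FF_geo_gt (α := α) (by linarith : 0 < σ) h2 hk
  have h5 := calib (P := P) (Q := geo (2 * k) α s) (k := k) (σ₀ := σ - d) (by linarith)
    (by rw [← hd]; simpa using h4)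
  rw [← hd] at h5
  have h6 : FF k (σ - d) P ≤ dH HO P := calib_O_lt (by linarith)
    (lt_of_le_of_lt (by gcongr; linarith) h4)
  simp at h5
  linarith

lemma triangle (P Q S : H) : dH P S ≤ dH P Q + dH Q S := by
  have := triangle_O (Hmul (Hinv P) Q) (Hmul (Hinv P) S)
  rwa [dH_trans, ← dH_N, ← dH_N] at this



lemma abs_mul_pi_mm {k s : ℝ} (h : |k| * s = Real.pi) : mm k s = 0 := by
  have hk : k ≠ 0 := by rintro rfl; simp at h; exact Real.pi_ne_zero h.symm
  simp only [mm, hk, if_false]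
  rcases abs_cases k with ⟨h1, -⟩ | ⟨h1, -⟩
  · rw [h1] at h; rw [h]; simp
  · rw [h1] at h
    have : k * s = -Real.pi := by linarith
    rw [this]; simp

lemma dH_axis (t : ℝ) : dH HO (0, 0, t) = Real.sqrt (Real.pi * |t|) := by
  obtain ⟨k, α, s, hs, hk, h⟩ := geo_surj (0, 0, t)
  have hN := dH_O_geo (α := α) hs hk
  rw [h] at hN
  rw [hN]
  have hr := rr_geo k α s
  rw [h] at hr
  have hm : mm k s = 0 := by
    have : mm k s ^ 2 = 0 := by rw [← hr]; simp
    simpa using this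
  have ht : tau k s = t := by
    rw [geo_eq] at h
    exact congrArg (fun p : H => p.2.2) h
  rcases hs.eq_or_lt with rfl | hs
  · rw [← ht]; simp [tau]
  · have hpi : |k| * s = Real.pi := by
      by_contra hne
      exact (mm_pos hs (lt_of_le_of_ne hk hne)).ne' hm
    have hk0 : k ≠ 0 := by rintro rfl; simp at hpi; exact Real.pi_ne_zero hpi.symm
    have hsin : Real.sin (k * s) = 0 := by
      simpa [mm, hk0] using hm
    have : t = s / k := by rw [← ht]; simp [tau, hk0, hsin]
    rw [this, abs_div, abs_of_pos hs, ← hpi]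
    have hk' : |k| ≠ 0 := by simpa using hk0
    rw [show |k| * s * (s / |k|) = s ^ 2 by field_simp, Real.sqrt_sq hs.le]

lemma dH_northPole {R : ℝ} (hR : 0 ≤ R) : dH HO (northPole R) = R := by
  unfold northPole
  rw [dH_axis, abs_of_nonneg (by positivity)]
  rw [show Real.pi * (R ^ 2 / Real.pi) = R ^ 2 by field_simp, Real.sqrt_sq hR]

lemma N_bound (p : H) : dH HO p ≤ Real.sqrt (p.1 ^ 2 + p.2.1 ^ 2) + Real.sqrt (Real.pi * |p.2.2|) := by
  obtain ⟨x, y, t⟩ := p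
  simp only
  have h1 : dH HO (x, y, 0) ≤ Real.sqrt (x ^ 2 + y ^ 2) := by
    have hz : ‖(⟨x, y⟩ : ℂ)‖ = Real.sqrt (x ^ 2 + y ^ 2) := by
      rw [Complex.norm_def, Complex.normSq_mk]; congr 1; ring
    have := dH_le (adm_geo_O 0 (Complex.arg ⟨x, y⟩) (Real.sqrt (x ^ 2 + y ^ 2)) (Real.sqrt_nonneg _))
    rw [geo_eq] at this
    simp only [mm, tau, if_true, zero_mul, sub_zero] at this
    rw [← hz, Complex.norm_mul_cos_arg, Complex.norm_mul_sin_arg] at this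
    rw [← hz]
    exact this
  have h2 := triangle_O (x, y, 0) (x, y, t)
  rw [dH_N (x, y, 0)] at h2
  have e : Hmul (Hinv (x, y, 0)) (x, y, t) = (0, 0, t) := by
    unfold Hmul Hinv
    refine Prod.ext ?_ (Prod.ext ?_ ?_) <;> simp
  rw [e, dH_axis] at h2
  linarith

lemma continuous_N : Continuous (fun p => dH HO p) := by
  rw [continuous_iff_continuousAt]
  intro p
  set B : H → ℝ := fun p => Real.sqrt (p.1 ^ 2 + p.2.1 ^ 2) + Real.sqrt (Real.pi * |p.2.2|) with hB
  have hBc : Continuous B := by simp only [hB]; fun_prop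
  have hB0 : B HO = 0 := by simp [hB, HO]
  rw [ContinuousAt, tendsto_iff_dist_tendsto_zero]
  have h1 : Continuous (fun q => B (Hmul (Hinv p) q) + B (Hmul (Hinv q) p)) := by
    apply Continuous.add <;> apply hBc.comp <;> unfold Hmul Hinv <;> fun_prop
  have h2 := h1.tendsto p
  rw [Hinv_mul, hB0, add_zero] at h2
  refine squeeze_zero (fun _ => dist_nonneg) (fun q => ?_) h2
  have a1 := triangle_O p q
  have a2 := triangle_O q p
  rw [dH_N] at a1 a2
  rw [dH_N HO q, dH_N HO p] at *
  have b1 := N_bound (Hmul (Hinv p) q)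
  have b2 := N_bound (Hmul (Hinv q) p)
  have c1 : 0 ≤ B (Hmul (Hinv p) q) := by simp only [hB]; positivity
  have c2 : 0 ≤ B (Hmul (Hinv q) p) := by simp only [hB]; positivity
  rw [Real.dist_eq, abs_le]
  have d1 := triangle_O p q
  have d2 := triangle_O q p
  rw [dH_N p q] at d1
  rw [dH_N q p] at d2
  rw [dH_N HO q, dH_N HO p] at d1 d2
  simp only [hB] at c1 c2 ⊢
  constructor <;> linarith

lemma isCompact_sphereH {R : ℝ} (hR : 0 < R) : IsCompact {Q : H | dH HO Q = R} := by
  have hcl : IsClosed {Q : H | dH HO Q = R} := isClosed_eq continuous_N continuous_const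
  refine (isCompact_Icc (a := ((-R, -R, -(2 * R ^ 2 / Real.pi)) : H))
    (b := (R, R, 2 * R ^ 2 / Real.pi))).of_isClosed_subset hcl ?_
  rintro ⟨x, y, t⟩ hQ
  simp only [Set.mem_setOf_eq] at hQ
  have hpi := Real.pi_pos
  have h0 := calib_O (p := (x, y, t)) (k := 0) hR hQ.le (by simpa using hpi)
  have e1 : Real.pi / (2 * R) * R = Real.pi / 2 := by field_simp
  have h1 := calib_O (p := (x, y, t)) (k := Real.pi / (2 * R)) hR hQ.le
    (by rw [abs_of_pos (by positivity), e1]; linarith)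
  have h2 := calib_O (p := (x, y, t)) (k := -(Real.pi / (2 * R))) hR hQ.le
    (by rw [abs_neg, abs_of_pos (by positivity), e1]; linarith)
  simp only [FF, cc_neg] at h0 h1 h2
  have e2 : cc (Real.pi / (2 * R)) R = 0 := by simp only [cc, e1]; simp
  rw [e2, hQ] at h1 h2
  rw [hQ] at h0
  simp [cc, mm] at h0
  rw [inv_mul_le_iff₀ hR] at h0
  have e3 : 2 * R ^ 2 / Real.pi = R / (Real.pi / (2 * R)) := by field_simp
  have hp : 0 < Real.pi / (2 * R) := by positivity
  have hx : |x| ≤ R := abs_le_of_sq_le_sq (by nlinarith [sq_nonneg y]) hR.le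
  have hy : |y| ≤ R := abs_le_of_sq_le_sq (by nlinarith [sq_nonneg x]) hR.le
  rw [abs_le] at hx hy
  have ht1 : t ≤ 2 * R ^ 2 / Real.pi := by rw [e3, le_div_iff₀ hp]; linarith
  have ht2 : -t ≤ 2 * R ^ 2 / Real.pi := by rw [e3, le_div_iff₀ hp]; linarith
  exact ⟨⟨hx.1, hy.1, by simp only; linarith⟩, ⟨hx.2, hy.2, ht1⟩⟩

lemma geo_neg_s (k α u : ℝ) : geo (2 * k) α (-u) = geo (2 * (-k)) (α + Real.pi) u := by
  rw [geo_eq, geo_eq, mm_neg, tau_neg]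
  have h1 : mm k (-u) = - mm k u := by
    unfold mm; by_cases hk : k = 0 <;> simp [hk]; ring
  have h2 : tau k (-u) = - tau k u := by
    unfold tau; by_cases hk : k = 0 <;> simp [hk]; ring
  have e : α + Real.pi - -k * u = (α - k * -u) + Real.pi := by ring
  rw [h1, h2, e, Real.cos_add_pi, Real.sin_add_pi]
  simp

lemma dH_O_inv (p : H) : dH HO (Hinv p) = dH HO p := by
  obtain ⟨k, α, s, hs, hk, rfl⟩ := geo_surj p
  have : Hinv (geo (2 * k) α s) = geo (2 * (-k)) (α - 2 * k * s + Real.pi) s := by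
    rw [geo_eq, geo_eq, mm_neg, tau_neg]
    have e : α - 2 * k * s + Real.pi - -k * s = (α - k * s) + Real.pi := by ring
    rw [e, Real.cos_add_pi, Real.sin_add_pi]
    simp [Hinv]
  rw [this, dH_O_geo hs (by simpa using hk), dH_O_geo hs hk]

lemma mm_le_sub {k ρ R : ℝ} (h : |k| * ρ ≤ Real.pi) (hR : Real.pi ≤ |k| * R) :
    mm k ρ ≤ R - ρ := by
  wlog hk : 0 ≤ k with H
  · rw [← mm_neg]; exact H (by simpa using h) (by simpa using hR) (by linarith)
  rcases hk.eq_or_lt with rfl | hk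
  · simp at hR; linarith [Real.pi_pos]
  rw [abs_of_pos hk] at h hR
  simp only [mm, hk.ne', if_false]
  rw [div_le_iff₀ hk, ← Real.sin_pi_sub]
  have := Real.sin_le (show 0 ≤ Real.pi - k * ρ by linarith)
  nlinarith

lemma hasDerivAt_path (P : H) (k α s : ℝ) :
    HasDerivAt (fun s => Hmul P (geo (2 * k) α s))
      (Real.cos (α - 2 * k * s), Real.sin (α - 2 * k * s),
        2 * (Hmul P (geo (2 * k) α s)).2.1 * Real.cos (α - 2 * k * s)
        - 2 * (Hmul P (geo (2 * k) α s)).1 * Real.sin (α - 2 * k * s)) s := by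
  have h1 := ((trA P).hasFDerivAt.comp_hasDerivAt s (hasDerivAt_geo k α s)).const_add P
  simp only [Hmul_eq]
  refine HasDerivAt.congr_deriv h1 ?_
  rw [trA_apply, trA_apply]
  refine Prod.ext rfl (Prod.ext rfl ?_)
  simp
  ring

lemma zero_deriv_on {f : ℝ → ℝ} {f' u v σ : ℝ} (huv : u < v) (hσ : σ ∈ Set.Icc u v)
    (h0 : ∀ x ∈ Set.Icc u v, f x = 0) (hf : HasDerivAt f f' σ) : f' = 0 := by
  have h1 : HasDerivWithinAt f f' (Set.Icc u v) σ := hf.hasDerivWithinAt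
  have h2 : HasDerivWithinAt f 0 (Set.Icc u v) σ :=
    (hasDerivWithinAt_const σ (Set.Icc u v) (0:ℝ)).congr h0 (h0 σ hσ)
  exact (uniqueDiffOn_Icc huv σ hσ).eq_deriv _ h1 h2

lemma geo_congr {k α α' s : ℝ} (hc : Real.cos (α - 2 * k * s) = Real.cos (α' - 2 * k * s))
    (hs : Real.sin (α - 2 * k * s) = Real.sin (α' - 2 * k * s)) :
    geo (2 * k) α s = geo (2 * k) α' s := by
  rw [geo_eq, geo_eq]
  have e : ∀ a : ℝ, a - k * s = (a - 2 * k * s) + k * s := fun a => by ring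
  rw [e α, e α']
  simp only [Real.cos_add, Real.sin_add, hc, hs]



lemma cont_path (P : H) (k α : ℝ) : Continuous (fun s => Hmul P (geo (2 * k) α s)) :=
  continuous_iff_continuousAt.2 fun s => (hasDerivAt_path P k α s).continuousAt

lemma path_step (P : H) (k α s ε : ℝ) (hε : 0 ≤ ε) :
    dH (Hmul P (geo (2 * k) α (s - ε))) (Hmul P (geo (2 * k) α s)) ≤ ε := by
  have h := geo_add k α (s - ε) ε
  rw [sub_add_cancel] at h
  rw [← h, ← Hmul_assoc]
  exact dH_geo_le _ _ _ _ hε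

lemma step1 {P : H} {R D k α ε : ℝ} (hP : dH HO P = 1) (hR : 1 < R)
    (hQ : dH HO (Hmul P (geo (2 * k) α D)) = R)
    (hmin : ∀ Q', dH HO Q' = R → D ≤ dH P Q') (hε : 0 < ε) (hεD : ε < D)
    (hr : ε ^ 2 < (Hmul P (geo (2 * k) α (D - ε))).1 ^ 2 + (Hmul P (geo (2 * k) α (D - ε))).2.1 ^ 2) :
    dH HO (Hmul P (geo (2 * k) α (D - ε))) = R - ε := by
  have h1 := dH_geo_le P k α (D - ε) (by linarith)
  have h2 := path_step P k α D ε hε.le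
  set W := Hmul P (geo (2 * k) α (D - ε)) with hW
  have h3 := triangle_O W (Hmul P (geo (2 * k) α D))
  rw [hQ] at h3
  have hlt : dH HO W < R := by
    by_contra hc
    push Not at hc
    have hcont : ContinuousOn (fun s => dH HO (Hmul P (geo (2 * k) α s))) (Set.Icc 0 (D - ε)) :=
      (continuous_N.comp (cont_path P k α)).continuousOn
    have := intermediate_value_Icc (by linarith) hcont
    have h4 : R ∈ Set.Icc (dH HO (Hmul P (geo (2 * k) α 0))) (dH HO (Hmul P (geo (2 * k) α (D - ε)))) := by
      rw [geo_zero, mul_HO, hP]; exact ⟨hR.le, hc⟩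
    obtain ⟨s, hs, hsR⟩ := this h4
    have h5 := hmin _ hsR
    have h6 := dH_geo_le P k α s hs.1
    linarith [hs.2]
  obtain ⟨k', α', ρ, hρ, hk', hWg⟩ := geo_surj W
  have hN : dH HO W = ρ := by rw [← hWg]; exact dH_O_geo hρ hk'
  rw [hN] at hlt h3 ⊢
  have hkR : |k'| * R ≤ Real.pi := by
    by_contra hc
    push Not at hc
    have h7 := mm_le_sub hk' hc.le
    have h8 := mm_mem hρ hk'
    have h9 := rr_geo k' α' ρ
    rw [hWg] at h9
    rw [h9] at hr
    nlinarith
  have hQ'' := dH_O_geo (α := α') (by linarith : 0 ≤ R) hkR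
  have h10 := hmin _ hQ''
  have h11 := triangle P W (geo (2 * k') α' R)
  have h12 : dH W (geo (2 * k') α' R) ≤ R - ρ := by
    have h := geo_add k' α' ρ (R - ρ)
    rw [add_sub_cancel, hWg] at h
    rw [← h]
    exact dH_geo_le _ _ _ _ (by linarith)
  linarith

lemma step2 {P : H} {R D k α κ β ε₀ : ℝ} 
    (hQg : Hmul P (geo (2 * k) α D) = geo (2 * κ) β R) (hκ : |κ| * R < Real.pi)
    (hεR : ε₀ < R)
    (hε : ∀ ε, 0 ≤ ε → ε ≤ ε₀ → dH HO (Hmul P (geo (2 * k) α (D - ε))) = R - ε) :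
    ∀ σ ∈ Set.Icc (R - ε₀) R, FF κ σ (Hmul P (geo (2 * k) α (D - R + σ))) - σ = 0 := by
  intro σ hσ
  have hσ0 : 0 < σ := by linarith [hσ.1]
  have hN := hε (R - σ) (by linarith [hσ.2]) (by linarith [hσ.1])
  have e : D - (R - σ) = D - R + σ := by ring
  have h2 := path_step P k α D (R - σ) (by linarith [hσ.2])
  rw [e] at hN h2
  set W := Hmul P (geo (2 * k) α (D - R + σ)) with hW
  have hN' : dH HO W = σ := by linarith
  have hRn : dH HO (Hmul P (geo (2 * k) α D)) = R := by
    rw [hQg]; exact dH_O_geo (by linarith [hσ.2]) hκ.le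
  have h3 := triangle_O W (Hmul P (geo (2 * k) α D))
  have hd : dH W (Hmul P (geo (2 * k) α D)) = R - σ := by linarith
  have h4 := calib_O (p := W) (k := κ) hσ0 hN'.le
    (lt_of_le_of_lt (by gcongr; exact hσ.2) hκ)
  have h5 := calib (P := W) (Q := Hmul P (geo (2 * k) α D)) (k := κ) (σ₀ := σ) hσ0
    (by rw [hd]; simpa using hκ)
  rw [hd, add_sub_cancel, hQg, FF_geo (mm_pos (by linarith [hσ.2]) hκ).ne'] at h5
  linarith

lemma k_mul_mm (k s : ℝ) : k * mm k s = Real.sin (k * s) := by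
  unfold mm; by_cases hk : k = 0
  · simp [hk]
  · simp only [hk, if_false]; field_simp

lemma step3 {P : H} {R D k α κ β ε₀ : ℝ} (hε0 : 0 < ε₀)
    (hQg : Hmul P (geo (2 * k) α D) = geo (2 * κ) β R) (hκ : |κ| * R < Real.pi)
    (hεR : ε₀ < R)
    (h0 : ∀ σ ∈ Set.Icc (R - ε₀) R, FF κ σ (Hmul P (geo (2 * k) α (D - R + σ))) - σ = 0) :
    P = geo (2 * κ) β (R - D) := by
  set γ : ℝ → H := fun σ => Hmul P (geo (2 * k) α (D - R + σ)) with hγ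
  have hlt : R - ε₀ < R := by linarith
  have hγd : ∀ σ, HasDerivAt γ (Real.cos (α - 2 * k * (D - R + σ)), Real.sin (α - 2 * k * (D - R + σ)),
        2 * (γ σ).2.1 * Real.cos (α - 2 * k * (D - R + σ))
        - 2 * (γ σ).1 * Real.sin (α - 2 * k * (D - R + σ))) σ := fun σ =>
    HasDerivAt.comp_const_add (D - R) σ (hasDerivAt_path P k α (D - R + σ))
  have hx : ∀ σ, HasDerivAt (fun σ => (γ σ).1) (Real.cos (α - 2 * k * (D - R + σ))) σ :=
    fun σ => (hγd σ).fst
  have hy : ∀ σ, HasDerivAt (fun σ => (γ σ).2.1) (Real.sin (α - 2 * k * (D - R + σ))) σ :=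
    fun σ => (hγd σ).snd.fst
  have ht : ∀ σ, HasDerivAt (fun σ => (γ σ).2.2) (2 * (γ σ).2.1 * Real.cos (α - 2 * k * (D - R + σ))
        - 2 * (γ σ).1 * Real.sin (α - 2 * k * (D - R + σ))) σ :=
    fun σ => (hγd σ).snd.snd
  have hm : ∀ σ ∈ Set.Icc (R - ε₀) R, mm κ σ ≠ 0 := fun σ hσ =>
    (mm_pos (by linarith [hσ.1]) (lt_of_le_of_lt (by gcongr; exact hσ.2) hκ)).ne'
  have key : ∀ σ ∈ Set.Icc (R - ε₀) R,
      cc κ σ * (γ σ).1 + κ * (γ σ).2.1 - Real.cos (α - 2 * k * (D - R + σ)) = 0 ∧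
      cc κ σ * (γ σ).2.1 - κ * (γ σ).1 - Real.sin (α - 2 * k * (D - R + σ)) = 0 := by
    intro σ hσ
    have hd := (((hasDerivAt_cc κ σ (hm σ hσ)).mul (((hx σ).pow 2).add ((hy σ).pow 2))).add
      ((ht σ).const_mul κ)).sub (hasDerivAt_id σ)
    have hz := zero_deriv_on hlt hσ (f := fun σ => FF κ σ (γ σ) - σ) h0 hd
    have h1 := Real.sin_sq_add_cos_sq (α - 2 * k * (D - R + σ))
    simp only [Pi.add_apply, Pi.pow_apply] at hz
    set a := Real.cos (α - 2 * k * (D - R + σ))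
    set b := Real.sin (α - 2 * k * (D - R + σ))
    set x := (γ σ).1
    set y := (γ σ).2.1
    set c := cc κ σ
    have hs : (c * x + κ * y - a) ^ 2 + (c * y - κ * x - b) ^ 2 = 0 := by
      push_cast at hz
      linear_combination -hz + h1
    constructor <;> nlinarith [sq_nonneg (c * x + κ * y - a), sq_nonneg (c * y - κ * x - b)]
  have hRm : R ∈ Set.Icc (R - ε₀) R := ⟨hlt.le, le_rfl⟩
  have hang : ∀ σ, HasDerivAt (fun σ => α - 2 * k * (D - R + σ)) (-(2 * k)) σ := fun σ => by
    have := (((hasDerivAt_id σ).const_add (D - R)).const_mul (2 * k)).const_sub α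
    simpa using this
  have z1 := zero_deriv_on hlt hRm (fun σ hσ => (key σ hσ).1)
    ((((hasDerivAt_cc κ R (hm R hRm)).mul (hx R)).add ((hy R).const_mul κ)).sub (hang R).cos)
  have z2 := zero_deriv_on hlt hRm (fun σ hσ => (key σ hσ).2)
    ((((hasDerivAt_cc κ R (hm R hRm)).mul (hy R)).sub ((hx R).const_mul κ)).sub (hang R).sin)
  obtain ⟨w1, w2⟩ := key R hRm
  have hγR : γ R = geo (2 * κ) β R := by rw [← hQg]; simp only [hγ]; rw [sub_add_cancel]
  rw [sub_add_cancel] at z1 z2 w1 w2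
  have h1 := Real.sin_sq_add_cos_sq (α - 2 * k * D)
  have hkk : k = κ := by
    set a := Real.cos (α - 2 * k * D)
    set b := Real.sin (α - 2 * k * D)
    set x := (γ R).1
    set y := (γ R).2.1
    set c := cc κ R
    have e1 : 2 * (κ - k) * b = 0 := by linear_combination z1 + c * w1 - κ * w2
    have e2 : 2 * (κ - k) * a = 0 := by linear_combination -z2 - c * w2 - κ * w1
    have : 2 * (κ - k) * (b ^ 2 + a ^ 2) = 0 := by linear_combination b * e1 + a * e2
    rw [h1] at this; linarith
  subst hkk
  rw [hγR, geo_eq] at w1 w2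
  simp only at w1 w2
  have q1 : cc k R * mm k R = Real.cos (k * R) := by
    unfold cc; exact div_mul_cancel₀ _ (hm R hRm)
  have q2 := k_mul_mm k R
  have c1 : Real.cos (α - 2 * k * D) = Real.cos (β - 2 * k * R) := by
    rw [show β - 2 * k * R = (β - k * R) - k * R by ring, Real.cos_sub (β - k * R)]
    linear_combination -w1 + Real.cos (β - k * R) * q1 + Real.sin (β - k * R) * q2
  have c2 : Real.sin (α - 2 * k * D) = Real.sin (β - 2 * k * R) := by
    rw [show β - 2 * k * R = (β - k * R) - k * R by ring, Real.sin_sub (β - k * R)]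
    linear_combination -w2 + Real.sin (β - k * R) * q1 - Real.cos (β - k * R) * q2
  have e : β - 2 * k * (R - D) - 2 * k * D = β - 2 * k * R := by ring
  have h5 : geo (2 * k) α D = geo (2 * k) (β - 2 * k * (R - D)) D :=
    geo_congr (by rw [e, c1]) (by rw [e, c2])
  have h6 := geo_add k β (R - D) D
  rw [sub_add_cancel] at h6
  rw [h5, ← h6] at hQg
  exact Hmul_right_cancel hQg

lemma minimizer_axis {P Q : H} {R : ℝ} (hP : dH HO P = 1) (hR : 1 < R) (hQ : dH HO Q = R)
    (hmin : ∀ Q', dH HO Q' = R → dH P Q ≤ dH P Q') (hr : Q.1 ^ 2 + Q.2.1 ^ 2 ≠ 0) :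
    ∃ κ β, |κ| * R < Real.pi ∧ P = geo (2 * κ) β 1 := by
  have hPO : dH P HO = 1 := by rw [dH_N, mul_HO, dH_O_inv, hP]
  have t1 := triangle_O P Q
  have t2 := triangle P HO Q
  rw [hP, hQ] at t1
  rw [hPO, hQ] at t2
  obtain ⟨κ, β, s, hs, hκ, hg⟩ := geo_surj Q
  have hsR : s = R := by rw [← hQ, ← hg, dH_O_geo hs hκ]
  subst hsR
  have hκ' : |κ| * s < Real.pi := by
    refine lt_of_le_of_ne hκ fun h => hr ?_
    rw [← hg, rr_geo, abs_mul_pi_mm h]; simp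
  obtain ⟨k, α, D, hD, hk, hg1⟩ := geo_surj (Hmul (Hinv P) Q)
  have hDe : dH P Q = D := by rw [dH_N, ← hg1, dH_O_geo hD hk]
  rw [hDe] at t1 t2 hmin
  have hQe : Hmul P (geo (2 * k) α D) = Q := by rw [hg1, mul_Hinv_cancel]
  have hD0 : 0 < D := by linarith
  obtain ⟨ε₀, he0, heD, heR, her⟩ : ∃ ε₀, 0 < ε₀ ∧ ε₀ < D ∧ ε₀ < s ∧ ∀ ε, 0 ≤ ε → ε ≤ ε₀ →
      ε ^ 2 < (Hmul P (geo (2 * k) α (D - ε))).1 ^ 2 + (Hmul P (geo (2 * k) α (D - ε))).2.1 ^ 2 := by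
    have hc : Continuous (fun ε => (Hmul P (geo (2 * k) α (D - ε))).1 ^ 2
        + (Hmul P (geo (2 * k) α (D - ε))).2.1 ^ 2 - ε ^ 2) := by
      have := (cont_path P k α).comp (continuous_const.sub continuous_id : Continuous fun ε : ℝ => D - ε)
      exact (((continuous_fst.comp this).pow 2).add
        ((continuous_fst.comp (continuous_snd.comp this)).pow 2)).sub (continuous_id.pow 2)
    have h0 : 0 < (fun ε => (Hmul P (geo (2 * k) α (D - ε))).1 ^ 2
        + (Hmul P (geo (2 * k) α (D - ε))).2.1 ^ 2 - ε ^ 2) 0 := by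
      simp only [sub_zero]
      rw [hQe]
      have : 0 ≤ Q.1 ^ 2 + Q.2.1 ^ 2 := by positivity
      have := lt_of_le_of_ne this hr.symm
      simpa using this
    have := hc.continuousAt.eventually (lt_mem_nhds h0)
    obtain ⟨δ, hδ, hb⟩ := Metric.eventually_nhds_iff.1 this
    refine ⟨min (δ / 2) (min (D / 2) (s / 2)), ?_, ?_, ?_, ?_⟩
    · have : 0 < s := by linarith
      positivity
    · have := (min_le_right (δ / 2) _).trans (min_le_left (D / 2) (s / 2)); linarith
    · have := (min_le_right (δ / 2) _).trans (min_le_right (D / 2) (s / 2)); linarith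
    · intro ε h1 h2
      have h3 := h2.trans (min_le_left _ _)
      have := hb (y := ε) (by rw [Real.dist_eq, sub_zero, abs_of_nonneg h1]; linarith)
      linarith
  have hall : ∀ ε, 0 ≤ ε → ε ≤ ε₀ → dH HO (Hmul P (geo (2 * k) α (D - ε))) = s - ε := by
    intro ε h1 h2
    rcases h1.eq_or_lt with rfl | h1
    · rw [sub_zero, sub_zero, hQe, hQ]
    · exact step1 hP hR (by rw [hQe, hQ]) hmin h1 (by linarith) (her ε h1.le h2)
  have hQg : Hmul P (geo (2 * k) α D) = geo (2 * κ) β s := by rw [hQe, hg]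
  have hfin := step3 he0 hQg hκ' heR (step2 hQg hκ' heR hall)
  rcases le_total D s with h | h
  · have hle : |κ| * (s - D) ≤ Real.pi := le_trans (by gcongr; linarith) hκ
    have := dH_O_geo (α := β) (by linarith : 0 ≤ s - D) hle
    rw [← hfin, hP] at this
    exact ⟨κ, β, hκ', by rw [hfin, ← this]⟩
  · have e : s - D = -(D - s) := by ring
    rw [e, geo_neg_s] at hfin
    have hle : |-κ| * (D - s) ≤ Real.pi := by
      rw [abs_neg]; exact le_trans (by gcongr; linarith) hκ
    have := dH_O_geo (α := β + Real.pi) (by linarith : 0 ≤ D - s) hle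
    rw [← hfin, hP] at this
    exact ⟨-κ, β + Real.pi, by simpa using hκ', by rw [hfin, ← this]⟩



lemma sin_conc {x y : ℝ} (hx : 0 < x) (hxy : x < y) (hy : y ≤ Real.pi) :
    x * Real.sin y < y * Real.sin x := by
  have hy0 : 0 < y := hx.trans hxy
  have m0 : (0:ℝ) ∈ Set.Icc 0 Real.pi := ⟨le_rfl, Real.pi_pos.le⟩
  have m1 : y ∈ Set.Icc 0 Real.pi := ⟨hy0.le, hy⟩
  have a1 : 0 < 1 - x / y := by rw [sub_pos, div_lt_one hy0]; exact hxy
  have a2 : 0 < x / y := by positivity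
  have h := strictConcaveOn_sin_Icc.2 m0 m1 hy0.ne a1 a2 (by ring)
  simp only [smul_eq_mul, Real.sin_zero, mul_zero, zero_add] at h
  rw [div_mul_cancel₀ _ hy0.ne'] at h
  rw [div_mul_eq_mul_div, div_lt_iff₀ hy0] at h
  linarith

lemma mm_abs (k s : ℝ) : mm |k| s = mm k s := by
  rcases abs_cases k with ⟨h, -⟩ | ⟨h, -⟩ <;> rw [h]
  exact mm_neg _ _

lemma mm_inj {a b : ℝ} (ha : 0 < a) (hb : 0 < b) (ha' : a ≤ Real.pi) (hb' : b ≤ Real.pi)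
    (h : mm a 1 = mm b 1) : a = b := by
  simp only [mm, ha.ne', hb.ne', if_false, mul_one] at h
  rw [div_eq_div_iff ha.ne' hb.ne'] at h
  rcases lt_trichotomy a b with h1 | h1 | h1
  · have := sin_conc ha h1 hb'; linarith
  · exact h1
  · have := sin_conc hb h1 ha'; linarith

lemma lam_unique {P : H} {k₀ α₀ κ β : ℝ} (h0 : k₀ ≠ 0) (hk0 : |k₀| ≤ Real.pi)
    (hκ : |κ| ≤ Real.pi) (ht : 0 < P.2.2)
    (h1 : geo (2 * k₀) α₀ 1 = P) (h2 : P = geo (2 * κ) β 1) : |k₀| = |κ| := by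
  have hκ0 : κ ≠ 0 := by
    rintro rfl
    rw [h2, geo_eq] at ht
    simp [tau] at ht
  have e1 := rr_geo k₀ α₀ 1
  have e2 := rr_geo κ β 1
  rw [h1] at e1
  rw [← h2, e1] at e2
  have p1 := mm_mem (k := k₀) (s := 1) zero_le_one (by simpa using hk0)
  have p2 := mm_mem (k := κ) (s := 1) zero_le_one (by simpa using hκ)
  have e3 : mm k₀ 1 = mm κ 1 := by
    rwa [sq_eq_sq₀ p1 p2] at e2
  rw [← mm_abs k₀, ← mm_abs κ] at e3
  exact mm_inj (abs_pos.2 h0) (abs_pos.2 hκ0) hk0 hκ e3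

lemma N_vert {x y u v : ℝ} (huv : |u| < -v) : dH HO (x, y, u) < dH HO (x, y, v) := by
  by_cases hr : x ^ 2 + y ^ 2 = 0
  · have hx : x = 0 := by nlinarith [sq_nonneg x, sq_nonneg y]
    have hy : y = 0 := by nlinarith [sq_nonneg x, sq_nonneg y]
    subst hx hy
    rw [dH_axis, dH_axis]
    have hv : |v| = -v := abs_of_neg (by linarith [abs_nonneg u])
    apply Real.sqrt_lt_sqrt (by positivity)
    rw [hv]
    have := Real.pi_pos
    gcongr
  by_contra hc
  push Not at hc
  obtain ⟨k, α, s, hs, hk, hg⟩ := geo_surj (x, y, u)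
  have hN : dH HO (x, y, u) = s := by rw [← hg, dH_O_geo hs hk]
  rw [hN] at hc
  have hrr := rr_geo k α s
  rw [hg] at hrr
  simp only at hrr
  have hs0 : 0 < s := by
    refine lt_of_le_of_ne hs fun h => hr ?_
    rw [hrr, ← h]; simp [mm]
  have hk' : |k| * s < Real.pi := by
    refine lt_of_le_of_ne hk fun h => hr ?_
    rw [hrr, abs_mul_pi_mm h]; simp
  by_cases hk0 : k = 0
  · subst hk0
    obtain ⟨k', α', s', hs', hk1, hg'⟩ := geo_surj (x, y, v)
    have hN' : dH HO (x, y, v) = s' := by rw [← hg', dH_O_geo hs' hk1]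
    have hrr' := rr_geo k' α' s'
    rw [hg'] at hrr'
    simp only at hrr'
    have hs0' : 0 < s' := by
      refine lt_of_le_of_ne hs' fun h => hr ?_
      rw [hrr', ← h]; simp [mm]
    have hk'0 : k' ≠ 0 := by
      rintro rfl
      rw [geo_eq] at hg'
      have : tau 0 s' = v := congrArg (fun p : H => p.2.2) hg'
      simp [tau] at this
      linarith [abs_nonneg u]
    have h1 := mm_lt hk'0 hs0'
    have h2 := mm_mem hs' hk1
    have h3 : mm 0 s = s := by simp [mm]
    rw [h3, hrr'] at hrr
    rw [hN'] at hc
    nlinarith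
  · have h1 := calib_O (p := (x, y, v)) (k := -|k|) hs0 hc (by simpa using hk')
    have h2 := FF_geo (α := α) (mm_pos hs0 hk').ne'
    rw [hg] at h2
    have h3 : cc (-|k|) s = cc k s := by
      rcases abs_cases k with ⟨h, -⟩ | ⟨h, -⟩ <;> rw [h]
      · exact cc_neg _ _
      · simp
    simp only [FF, h3] at h1 h2
    have h4 : k * u ≤ |k| * |u| := by rw [← abs_mul]; exact le_abs_self _
    have h5 : |k| * |u| < |k| * (-v) := by
      have := abs_pos.2 hk0
      gcongr
    linarith

lemma south_lt {P : H} {R : ℝ} (ht : 0 < P.2.2) (hR : 0 < R) :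
    dH P (northPole R) < dH P (0, 0, -(R ^ 2 / Real.pi)) := by
  rw [dH_N P, dH_N P]
  have hT : 0 < R ^ 2 / Real.pi := by have := Real.pi_pos; positivity
  simp only [northPole, Hmul, Hinv]
  set T := R ^ 2 / Real.pi
  have h := N_vert (x := -P.1) (y := -P.2.1) (u := -P.2.2 + T) (v := -P.2.2 + -T)
    (by rw [abs_lt]; constructor <;> linarith)
  simpa using h

lemma on_axis {Q : H} {R : ℝ} (hR : 0 < R) (hQ : dH HO Q = R) (hr : Q.1 ^ 2 + Q.2.1 ^ 2 = 0) :
    Q = northPole R ∨ Q = (0, 0, -(R ^ 2 / Real.pi)) := by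
  obtain ⟨x, y, t⟩ := Q
  simp only at hr
  have hx : x = 0 := by nlinarith [sq_nonneg x, sq_nonneg y]
  have hy : y = 0 := by nlinarith [sq_nonneg x, sq_nonneg y]
  subst hx hy
  rw [dH_axis] at hQ
  have hpi := Real.pi_pos
  have h1 : Real.pi * |t| = R ^ 2 := by
    rw [← hQ, Real.sq_sqrt (by positivity)]
  have h2 : |t| = R ^ 2 / Real.pi := by rw [← h1]; field_simp
  rw [← h2, northPole, ← h2]
  rcases abs_cases t with ⟨h, -⟩ | ⟨h, -⟩ <;> rw [h]
  · left; rfl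
  · right; simp

lemma sphereDist_eq {P Q : H} {R : ℝ} (hQ : dH HO Q = R)
    (hmin : ∀ Q', dH HO Q' = R → dH P Q ≤ dH P Q') : sphereDist P R = dH P Q := by
  have : IsLeast { d : ℝ | ∃ Q : H, dH HO Q = R ∧ d = dH P Q } (dH P Q) := by
    refine ⟨⟨Q, hQ, rfl⟩, ?_⟩
    rintro _ ⟨Q', h, rfl⟩
    exact hmin Q' h
  exact this.csInf_eq

lemma exists_min (P : H) {R : ℝ} (hR : 0 < R) :
    ∃ Q, dH HO Q = R ∧ ∀ Q', dH HO Q' = R → dH P Q ≤ dH P Q' := by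
  have hc : Continuous (fun Q => dH P Q) := by
    have : (fun Q => dH P Q) = fun Q => dH HO (Hmul (Hinv P) Q) := funext fun Q => dH_N P Q
    rw [this]
    refine continuous_N.comp ?_
    unfold Hmul
    fun_prop
  obtain ⟨Q, hQ, h⟩ := (isCompact_sphereH hR).exists_isMinOn ⟨northPole R, dH_northPole hR.le⟩
    hc.continuousOn
  exact ⟨Q, hQ, fun Q' hQ' => h hQ'⟩

lemma FF_lt_one {P : H} {k α x : ℝ} (hx : 0 < x) (hxk : x < k) (hk : k ≤ Real.pi)
    (h : geo (2 * k) α 1 = P) : FF x 1 P < 1 := by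
  have hk0 : 0 < k := hx.trans hxk
  unfold FF
  have hrr := rr_geo k α 1
  rw [h] at hrr
  have ht : P.2.2 = tau k 1 := by rw [← h, geo_eq]
  rw [hrr, ht]
  simp only [cc, mm, tau, hk0.ne', hx.ne', if_false, mul_one]
  have sx : 0 < Real.sin x := Real.sin_pos_of_pos_of_lt_pi hx (by linarith)
  have sk : 0 ≤ Real.sin k := Real.sin_nonneg_of_nonneg_of_le_pi hk0.le hk
  have h1 := sin_conc hx hxk hk
  have h2 : Real.sin (k - x) < k - x := Real.sin_lt (by linarith)
  have h3 : 0 ≤ Real.sin (k - x) :=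
    Real.sin_nonneg_of_nonneg_of_le_pi (by linarith) (by linarith)
  have h4 : x * Real.sin k * Real.sin (k - x) < k * Real.sin x * (k - x) := by
    have a1 : 0 < k * Real.sin x := by positivity
    nlinarith
  rw [Real.sin_sub] at h4
  have e : 1 - (Real.cos x / (Real.sin x / x) * (Real.sin k / k) ^ 2
      + x * (1 / k - Real.sin k * Real.cos k / k ^ 2))
      = (k * Real.sin x * (k - x) - x * Real.sin k * (Real.sin k * Real.cos x
        - Real.cos k * Real.sin x)) / (k ^ 2 * Real.sin x) := by
    field_simp
    ring
  have : 0 < 1 - (Real.cos x / (Real.sin x / x) * (Real.sin k / k) ^ 2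
      + x * (1 / k - Real.sin k * Real.cos k / k ^ 2)) := by
    rw [e]
    apply div_pos (by linarith) (by positivity)
  linarith

lemma north_strict {P : H} {R k α : ℝ} (hP : dH HO P = 1) (ht : 0 < P.2.2) (hR : 1 < R)
    (hk : |k| ≤ Real.pi) (h : geo (2 * k) α 1 = P) (hkR : Real.pi < |k| * R) :
    dH P (northPole R) ≠ R - 1 := by
  intro hd
  have hpi := Real.pi_pos
  have hkpos : 0 < k := by
    by_contra hc
    push Not at hc
    have h2 : 0 < tau k 1 := by rw [← h, geo_eq] at ht; exact ht
    rcases hc.eq_or_lt with h1 | h1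
    · simp [h1, tau] at h2
    · rw [← neg_neg k, tau_neg] at h2
      have hj : 0 < -k := by linarith
      set j := -k
      simp only [tau, hj.ne', if_false, mul_one] at h2
      have h3 : Real.sin j * Real.cos j ≤ j := by
        have := Real.sin_le (show 0 ≤ 2 * j by linarith)
        rw [Real.sin_two_mul] at this; linarith
      have h4 : Real.sin j * Real.cos j / j ^ 2 ≤ j / j ^ 2 := by gcongr
      have h5 : j / j ^ 2 = 1 / j := by field_simp
      linarith
  rw [abs_of_pos hkpos] at hk hkR
  have hx : 0 < Real.pi / R := by positivity
  have hxk : Real.pi / R < k := by rw [div_lt_iff₀ (by linarith)]; exact hkR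
  have hlt := FF_lt_one hx hxk hk h
  have hc : Filter.Tendsto (fun x => FF x 1 P) (nhdsWithin (Real.pi / R) (Set.Iio (Real.pi / R)))
      (nhds (FF (Real.pi / R) 1 P)) := by
    have : ContinuousAt (fun x => FF x 1 P) (Real.pi / R) := by
      have hev : (fun x => FF x 1 P) =ᶠ[nhds (Real.pi / R)] fun x =>
          Real.cos x / (Real.sin x / x) * (P.1 ^ 2 + P.2.1 ^ 2) + x * P.2.2 := by
        filter_upwards [lt_mem_nhds hx] with x hx
        simp [FF, cc, mm, hx.ne']
      refine ContinuousAt.congr ?_ hev.symm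
      have sx : 0 < Real.sin (Real.pi / R) := Real.sin_pos_of_pos_of_lt_pi hx (by linarith)
      have : Real.sin (Real.pi / R) / (Real.pi / R) ≠ 0 := by positivity
      have hx' := hx.ne'
      fun_prop (disch := assumption)
    exact this.tendsto.mono_left nhdsWithin_le_nhds
  have hl : Filter.Tendsto (fun x : ℝ => x * (R ^ 2 / Real.pi) - (R - 1))
      (nhdsWithin (Real.pi / R) (Set.Iio (Real.pi / R)))
      (nhds (Real.pi / R * (R ^ 2 / Real.pi) - (R - 1))) := by
    have : Continuous (fun x : ℝ => x * (R ^ 2 / Real.pi) - (R - 1)) := by fun_prop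
    exact (this.tendsto _).mono_left nhdsWithin_le_nhds
  have hle := le_of_tendsto_of_tendsto hl hc (by
    have h1 : ∀ᶠ x in nhdsWithin (Real.pi / R) (Set.Iio (Real.pi / R)), 0 < x :=
      nhdsWithin_le_nhds (lt_mem_nhds hx)
    filter_upwards [h1, self_mem_nhdsWithin] with x hx0 hxl
    have hxl : x < Real.pi / R := hxl
    rw [lt_div_iff₀ (by linarith)] at hxl
    have := calib (P := P) (Q := northPole R) (k := x) (σ₀ := 1) one_pos
      (by rw [hd, abs_of_pos hx0]; linarith)
    rw [hd] at this
    have e : FF x (1 + (R - 1)) (northPole R) = x * (R ^ 2 / Real.pi) := by simp [FF, northPole]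
    rw [e] at this
    linarith)
  have e : Real.pi / R * (R ^ 2 / Real.pi) = R := by field_simp
  rw [e] at hle
  linarith

/-- Lemma on distances to larger spheres.
Let `P = (z;t) ∈ S(O,1)` with `t > 0`, `R > 1`, `N_R = (0; R²/π) ∈ S(O,R)` and
let `l = λ(P)` be the `λ`-coordinate of `P`.
(i) If `l < R` then `dist(P, S(O,R)) > R − 1`.
(ii) If `l ≤ R` then `d(P, N_R) = dist(P, S(O,R))` and `N_R` is the unique point
of `S(O,R)` realizing this distance.
(iii) If `l > R` then `dist(P, S(O,R)) = R − 1`, realized by some point of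
`S(O,R)` different from `N_R`. -/
theorem statement10 :
    ∀ P : H, dH HO P = 1 → 0 < P.2.2 → ∀ R : ℝ, 1 < R →
    ∀ l : ℝ, IsLambdaCoord P l →
      (l < R → R - 1 < sphereDist P R) ∧
      (l ≤ R → dH P (northPole R) = sphereDist P R ∧
        ∀ Q : H, dH HO Q = R → dH P Q = sphereDist P R → Q = northPole R) ∧
      (R < l → sphereDist P R = R - 1 ∧
        ∃ Q : H, dH HO Q = R ∧ Q ≠ northPole R ∧ dH P Q = R - 1) := by
  intro P hP ht R hR l hl
  obtain ⟨φ, α, hφ, hle, hg, hlv⟩ := hl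
  rw [hP, mul_one] at hle hlv
  rw [hP] at hg
  obtain ⟨k, rfl⟩ : ∃ k, φ = 2 * k := ⟨φ / 2, by ring⟩
  have hpi := Real.pi_pos
  have hk0 : k ≠ 0 := by rintro rfl; simp at hφ
  have hkp : 0 < |k| := abs_pos.2 hk0
  have habs : |2 * k| = 2 * |k| := by rw [abs_mul]; simp
  rw [habs] at hle hlv
  have hk : |k| ≤ Real.pi := by linarith
  have hlv : l = Real.pi / |k| := by rw [hlv]; field_simp
  have hR0 : 0 < R := by linarith
  have hlow : ∀ Q, dH HO Q = R → R - 1 ≤ dH P Q := by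
    intro Q hQ
    have := triangle_O P Q
    rw [hP, hQ] at this; linarith
  have hii : l ≤ R → ∀ Q, dH HO Q = R → (∀ Q', dH HO Q' = R → dH P Q ≤ dH P Q') →
      Q = northPole R := by
    intro hlR Q hQ hmin
    by_cases hr : Q.1 ^ 2 + Q.2.1 ^ 2 = 0
    · rcases on_axis hR0 hQ hr with h | h
      · exact h
      · have h1 := hmin _ (dH_northPole hR0.le)
        have h2 := south_lt ht hR0
        rw [h] at h1
        linarith
    · exfalso
      obtain ⟨κ, β, h1, h2⟩ := minimizer_axis hP hR hQ hmin hr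
      have h3 : |κ| ≤ Real.pi := by nlinarith [abs_nonneg κ]
      have h4 := lam_unique hk0 hk h3 ht hg h2
      rw [hlv, div_le_iff₀ hkp, h4] at hlR
      linarith
  have hsd : l ≤ R → dH P (northPole R) = sphereDist P R := by
    intro hlR
    obtain ⟨Q, hQ, hmin⟩ := exists_min P hR0
    rw [sphereDist_eq hQ hmin, hii hlR Q hQ hmin]
  refine ⟨fun h => ?_, fun h => ⟨hsd h, fun Q hQ hd => ?_⟩, fun h => ?_⟩
  · rw [← hsd h.le]
    refine lt_of_le_of_ne (hlow _ (dH_northPole hR0.le)) (Ne.symm ?_)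
    refine north_strict hP ht hR hk hg ?_
    rw [hlv, div_lt_iff₀ hkp] at h
    linarith
  · refine hii h Q hQ fun Q' hQ' => ?_
    rw [hd]
    exact csInf_le ⟨0, by rintro _ ⟨S, -, rfl⟩; exact dH_nonneg _ _⟩ ⟨Q', hQ', rfl⟩
  · rw [hlv, lt_div_iff₀ hkp] at h
    have h' : |k| * R < Real.pi := by linarith
    have hN := dH_O_geo (α := α) hR0.le h'.le
    have hd : dH P (geo (2 * k) α R) = R - 1 := by
      refine le_antisymm ?_ (hlow _ hN)
      have h1 := geo_add k α 1 (R - 1)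
      rw [add_sub_cancel, hg] at h1
      rw [← h1]
      exact dH_geo_le _ _ _ _ (by linarith)
    refine ⟨?_, geo (2 * k) α R, hN, ?_, hd⟩
    · rw [← hd]
      exact sphereDist_eq hN fun Q' hQ' => by rw [hd]; exact hlow Q' hQ'
    · intro hc
      have h1 := rr_geo k α R
      rw [hc] at h1
      have h2 := mm_pos hR0 h'
      have h3 : 0 < mm k R ^ 2 := by positivity
      simp [northPole] at h1
      linarith
end
end

section
/- There exist constants R₀ > 0 and C₀ > 0 such that for every R > R₀, every r ∈ [1/2, 2], and every (z;t) ∈ S(O,r) with t > 0: if λ(z;t) ≥ R, then t ≤ C₀ R⁻¹ and 0 ≤ r − |z| ≤ C₀ R⁻². -/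
noncomputable section

open MeasureTheory

/-- Lemma, part (B): points of large `λ`-coordinate on spheres
of radius `r ∈ [1/2, 2]` lie near the equator. There are `R₀ > 0`, `C₀ > 0`
such that for all `R > R₀`, `r ∈ [1/2, 2]` and `(z;t) ∈ S(O,r)` with `t > 0`:
if `λ(z;t) ≥ R` then `t ≤ C₀ R⁻¹` and `0 ≤ r − |z| ≤ C₀ R⁻²`. -/
theorem statement11 :
    ∃ R₀ > (0:ℝ), ∃ C₀ > (0:ℝ),
      ∀ R : ℝ, R₀ < R → ∀ r : ℝ, r ∈ Set.Icc (1/2 : ℝ) 2 →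
      ∀ p : H, dH HO p = r → 0 < p.2.2 →
      ∀ l : ℝ, IsLambdaCoord p l → R ≤ l →
        p.2.2 ≤ C₀ / R ∧
        0 ≤ r - Real.sqrt (p.1 ^ 2 + p.2.1 ^ 2) ∧
        r - Real.sqrt (p.1 ^ 2 + p.2.1 ^ 2) ≤ C₀ / R ^ 2 := by
  refine ⟨7, by norm_num, 20, by norm_num, ?_⟩
  intro R hR r hr p hp ht l hl hRl
  obtain ⟨hr1, hr2⟩ := hr
  obtain ⟨φ, α, hφ, -, hgeo, hl⟩ := hl
  rw [hp] at hgeo hl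
  have hR0 : 0 < R := by linarith
  have hpi := Real.pi_lt_d2
  have hpi0 := Real.pi_pos
  have hr0 : 0 < r := by linarith
  have hf : 0 < |φ| := abs_pos.mpr hφ
  have hu0 : 0 < |φ| * r := mul_pos hf hr0
  have huR : |φ| * r * R ≤ 2 * Real.pi := by
    rw [hl, le_div_iff₀ hu0] at hRl
    linarith
  have hu1 : |φ| * r ≤ 1 := by nlinarith
  have hz : p.1 ^ 2 + p.2.1 ^ 2 = (2 * Real.sin (|φ| * r / 2) / |φ|) ^ 2 := by
    have h1 : Real.cos (φ * r) = 1 - 2 * Real.sin (|φ| * r / 2) ^ 2 := by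
      have h2 : Real.cos (φ * r) = Real.cos (2 * (|φ| * r / 2)) := by
        rw [← Real.cos_abs (φ * r), abs_mul, abs_of_pos hr0]
        congr 1
        ring
      rw [h2, Real.cos_two_mul]
      have := Real.sin_sq_add_cos_sq (|φ| * r / 2)
      linarith
    have h3 := Real.sin_sq_add_cos_sq (φ * r)
    have h4 := Real.sin_sq_add_cos_sq α
    rw [← hgeo, geo, if_neg hφ]
    simp only
    rw [div_pow, sq_abs]
    field_simp
    have h5 : (Real.sin α * (1 - Real.cos (φ * r)) + Real.cos α * Real.sin (φ * r)) ^ 2 +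
        (Real.sin α * Real.sin (φ * r) - Real.cos α * (1 - Real.cos (φ * r))) ^ 2 =
        (Real.sin α ^ 2 + Real.cos α ^ 2) * ((Real.sin (φ * r) ^ 2 + Real.cos (φ * r) ^ 2)
          + 1 - 2 * Real.cos (φ * r)) := by ring
    rw [h4, h3] at h5
    rw [mul_comm r |φ|]
    linear_combination h5 - 2 * h1
  have hw0 : 0 < |φ| * r / 2 := by linarith
  have hs1 := Real.sin_lt hw0
  have hs2 := Real.sin_gt_sub_cube hw0
  have hc := pow_pos hw0 3
  have hspos : 0 ≤ Real.sin (|φ| * r / 2) :=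
    Real.sin_nonneg_of_nonneg_of_le_pi hw0.le (by linarith [Real.pi_gt_three])
  rw [hz, Real.sqrt_sq (by positivity)]
  refine ⟨?_, ?_, ?_⟩
  · have ht2 : p.2.2 = 2 * (φ * r - Real.sin (φ * r)) / φ ^ 2 := by
      rw [← hgeo, geo, if_neg hφ]
    have hφ0 : 0 < φ := by
      by_contra hneg
      have hneg : φ < 0 := lt_of_le_of_ne (not_lt.mp hneg) hφ
      have h1 := Real.sin_lt (x := -(φ * r)) (by nlinarith)
      rw [Real.sin_neg] at h1
      have : p.2.2 ≤ 0 := by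
        rw [ht2]
        exact div_nonpos_of_nonpos_of_nonneg (by linarith) (by positivity)
      linarith
    rw [abs_of_pos hφ0] at *
    have h1 := Real.sin_gt_sub_cube hu0
    have hc2 := pow_pos hu0 3
    rw [ht2]
    have h2 : 2 * (φ * r - Real.sin (φ * r)) / φ ^ 2 ≤ r ^ 2 * (φ * r) / 2 := by
      rw [div_le_iff₀ (by positivity)]
      nlinarith
    refine h2.trans ?_
    rw [le_div_iff₀ hR0]
    have h3 : r ^ 2 ≤ 4 := by nlinarith
    nlinarith [mul_pos hu0 hR0]
  · rw [sub_nonneg, div_le_iff₀ hf]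
    linarith
  · have h1 : r - 2 * Real.sin (|φ| * r / 2) / |φ| ≤ r * (|φ| * r) ^ 2 / 16 := by
      rw [sub_le_iff_le_add, ← sub_le_iff_le_add', le_div_iff₀ hf]
      nlinarith
    refine h1.trans ?_
    rw [le_div_iff₀ (by positivity)]
    have h3 : (|φ| * r * R) ^ 2 ≤ 7 ^ 2 := by
      apply pow_le_pow_left₀ (by positivity)
      linarith
    have h4 : r * (|φ| * r) ^ 2 / 16 * R ^ 2 = r * (|φ| * r * R) ^ 2 / 16 := by ring
    rw [h4]
    nlinarith [sq_nonneg (|φ| * r * R)]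
end
end

section
/- For every λ ∈ (0,π) there exists C'_λ > 0 such that |ρ(θ) − ρ(φ)| ≥ C'_λ · |θ − |φ|| for all θ ∈ [0, π − λ] and all φ ∈ [−π + λ, π − λ]. -/
noncomputable section

open MeasureTheory

/-- `ρ(θ) = d((1,0,0), (cos θ, sin θ, 0))`. -/
def rho (θ : ℝ) : ℝ := dH (1, 0, 0) (Real.cos θ, Real.sin θ, 0)

theorem AC_comp {f g : ℝ → ℝ} {K : NNReal} {S : Set ℝ} {a b : ℝ}
    (hf : LipschitzOnWith K f S) (hg : AbsolutelyContinuousOnInterval g a b)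
    (hm : ∀ x ∈ Set.uIcc a b, g x ∈ S) :
    AbsolutelyContinuousOnInterval (fun x => f (g x)) a b := by
  rw [absolutelyContinuousOnInterval_iff] at hg ⊢
  intro ε hε
  obtain ⟨δ, hδ, h⟩ := hg (ε / (K + 1)) (by positivity)
  refine ⟨δ, hδ, fun E hE hs => ?_⟩
  have h1 := h E hE hs
  have h2 : ∑ i ∈ Finset.range E.1, dist (f (g (E.2 i).1)) (f (g (E.2 i).2)) ≤
      ∑ i ∈ Finset.range E.1, (K : ℝ) * dist (g (E.2 i).1) (g (E.2 i).2) := by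
    refine Finset.sum_le_sum fun i hi => ?_
    have := hE.1 i hi
    exact hf.dist_le_mul _ (hm _ this.1) _ (hm _ this.2)
  rw [← Finset.mul_sum] at h2
  have h3 : 0 ≤ ∑ i ∈ Finset.range E.1, dist (g (E.2 i).1) (g (E.2 i).2) :=
    Finset.sum_nonneg fun i _ => dist_nonneg
  rw [lt_div_iff₀ (by positivity)] at h1
  nlinarith

/-- pointwise calibration inequality -/
theorem calib_pt (M α a b w X Y s c : ℝ) (hM : 0 < M) (hs : 0 < s) (hsc : s ^ 2 + c ^ 2 = 1)
    (hw : 0 ≤ w) (hα : 0 < α) (hw2 : w ^ 2 = a ^ 2 + b ^ 2) :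
    α * (c / s * (2 * X * a + 2 * Y * b) - (α * w / M) / s ^ 2 * (X ^ 2 + Y ^ 2)
      + 2 * (Y * a - X * b)) ≤ M * w := by
  set p := c * X + s * Y with hp
  set q := c * Y - s * X with hq
  have hpq : p ^ 2 + q ^ 2 = X ^ 2 + Y ^ 2 := by
    rw [hp, hq]; linear_combination (X^2+Y^2) * hsc
  set n := Real.sqrt (p ^ 2 + q ^ 2) with hn
  have hn0 : 0 ≤ n := Real.sqrt_nonneg _
  have hn2 : n ^ 2 = p ^ 2 + q ^ 2 := Real.sq_sqrt (by positivity)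
  have hcs : a * p + b * q ≤ w * n := by
    refine le_of_abs_le (abs_le_of_sq_le_sq ?_ (by positivity))
    rw [mul_pow, hw2, hn2]
    nlinarith [sq_nonneg (a * q - b * p)]
  have e : M * w - α * (c / s * (2 * X * a + 2 * Y * b) - (α * w / M) / s ^ 2 * (X ^ 2 + Y ^ 2)
      + 2 * (Y * a - X * b)) = (w * (M - α * n / s) ^ 2 + 2 * α * M / s * (w * n - (a * p + b * q))) / M := by
    rw [← hpq, ← hn2, hp, hq]
    field_simp
    ring
  have : 0 ≤ (w * (M - α * n / s) ^ 2 + 2 * α * M / s * (w * n - (a * p + b * q))) / M := by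
    have := sub_nonneg.2 hcs
    positivity
  linarith

theorem calib_s13 (M α δ θ : ℝ) (hα : 0 < α) (hδ : 0 < δ) (hαδ : α + δ < Real.pi)
    (hM : rho θ < M) (hM0 : 0 < M)
    (hne : { L : ℝ | ∃ (γ : ℝ → H) (a b : ℝ → ℝ) (K : NNReal),
    LipschitzWith K γ ∧ γ 0 = (1, 0, 0) ∧ γ 1 = (Real.cos θ, Real.sin θ, 0) ∧
    (∀ᵐ s ∂volume, s ∈ Set.Icc (0:ℝ) 1 →
      HasDerivAt γ (a s, b s, 2 * (γ s).2.1 * a s - 2 * (γ s).1 * b s) s) ∧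
    IntervalIntegrable (fun s => Real.sqrt (a s ^ 2 + b s ^ 2)) volume 0 1 ∧
    L = ∫ s in (0:ℝ)..1, Real.sqrt (a s ^ 2 + b s ^ 2) }.Nonempty) :
    α * (Real.cos (α + δ) / Real.sin (α + δ) * (2 - 2 * Real.cos θ) + 2 * Real.sin θ) ≤ M ^ 2 := by
  obtain ⟨L, ⟨γ, a, b, K, hK, h0, h1, hd, hi, rfl⟩, hL⟩ := exists_lt_of_csInf_lt hne hM
  set w : ℝ → ℝ := fun s => Real.sqrt (a s ^ 2 + b s ^ 2) with hw
  set ell : ℝ → ℝ := fun s => ∫ v in (0:ℝ)..s, w v with hell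
  set τ : ℝ → ℝ := fun s => α / M * ell s + δ with hτ
  have hw0 : ∀ s, 0 ≤ w s := fun s => Real.sqrt_nonneg _
  have hell1 : ell 1 < M := hL
  have hellm : ∀ s ∈ Set.Icc (0:ℝ) 1, 0 ≤ ell s ∧ ell s ≤ ell 1 := by
    intro s hs
    have i1 : IntervalIntegrable w volume 0 s :=
      hi.mono_set (by rw [Set.uIcc_of_le hs.1, Set.uIcc_of_le zero_le_one]; exact Set.Icc_subset_Icc_right hs.2)
    have i2 : IntervalIntegrable w volume s 1 :=
      hi.mono_set (by rw [Set.uIcc_of_le hs.2, Set.uIcc_of_le zero_le_one]; exact Set.Icc_subset_Icc_left hs.1)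
    have e := intervalIntegral.integral_add_adjacent_intervals i1 i2
    have p1 : 0 ≤ ∫ v in (0:ℝ)..s, w v := intervalIntegral.integral_nonneg hs.1 fun u _ => hw0 u
    have p2 : 0 ≤ ∫ v in s..(1:ℝ), w v := intervalIntegral.integral_nonneg hs.2 fun u _ => hw0 u
    simp only [hell]
    exact ⟨p1, by linarith⟩
  have hτm : ∀ s ∈ Set.Icc (0:ℝ) 1, τ s ∈ Set.Icc δ (α + δ) := by
    intro s hs
    obtain ⟨p1, p2⟩ := hellm s hs
    have : α / M * ell s ≤ α / M * M := by gcongr; linarith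
    rw [div_mul_cancel₀ _ hM0.ne'] at this
    have h2 : 0 ≤ α / M * ell s := by positivity
    exact ⟨by simp only [hτ]; linarith, by simp only [hτ]; linarith⟩
  have hsin : ∀ t ∈ Set.Icc δ (α + δ), 0 < Real.sin t := fun t ht =>
    Real.sin_pos_of_pos_of_lt_pi (by linarith [ht.1]) (by linarith [ht.2])
  obtain ⟨K', hK'⟩ : ∃ K', LipschitzOnWith K' (fun t => Real.cos t / Real.sin t) (Set.Icc δ (α + δ)) := by
    refine ContDiffOn.exists_lipschitzOnWith (n := 1) ?_ (by decide) (convex_Icc _ _) isCompact_Icc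
    exact Real.contDiff_cos.contDiffOn.div Real.contDiff_sin.contDiffOn fun t ht => (hsin t ht).ne'
  have u01 : Set.uIcc (0:ℝ) 1 = Set.Icc 0 1 := Set.uIcc_of_le zero_le_one
  have acell : AbsolutelyContinuousOnInterval ell 0 1 :=
    hi.absolutelyContinuousOnInterval_intervalIntegral (by simp)
  have acconst : ∀ k : ℝ, AbsolutelyContinuousOnInterval (fun _ => k) 0 1 := fun k =>
    (LipschitzWith.const k).lipschitzOnWith.absolutelyContinuousOnInterval
  have acτ : AbsolutelyContinuousOnInterval τ 0 1 := (acell.const_mul _).fun_add (acconst δ)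
  have accot := AC_comp hK' acτ (by rw [u01]; exact hτm)
  have acx : AbsolutelyContinuousOnInterval (fun s => (γ s).1) 0 1 :=
    (LipschitzWith.prod_fst.comp hK).lipschitzOnWith.absolutelyContinuousOnInterval
  have acy : AbsolutelyContinuousOnInterval (fun s => (γ s).2.1) 0 1 :=
    ((LipschitzWith.prod_fst.comp LipschitzWith.prod_snd).comp hK).lipschitzOnWith.absolutelyContinuousOnInterval
  have act : AbsolutelyContinuousOnInterval (fun s => (γ s).2.2) 0 1 :=
    ((LipschitzWith.prod_snd.comp LipschitzWith.prod_snd).comp hK).lipschitzOnWith.absolutelyContinuousOnInterval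
  have acX := acx.fun_sub (acconst 1)
  set G : ℝ → ℝ := fun s => M * ell s - α * (Real.cos (τ s) / Real.sin (τ s) *
    (((γ s).1 - 1) * ((γ s).1 - 1) + (γ s).2.1 * (γ s).2.1) + ((γ s).2.2 + 2 * (γ s).2.1)) with hG
  have acG : AbsolutelyContinuousOnInterval G 0 1 :=
    (acell.const_mul M).fun_sub (((accot.fun_mul ((acX.fun_mul acX).fun_add (acy.fun_mul acy))).fun_add
      (act.fun_add (acy.const_mul 2))).const_mul α)
  have hG' : ∀ᵐ s, s ∈ Set.Icc (0:ℝ) 1 → 0 ≤ deriv G s := by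
    filter_upwards [hd, hi.ae_hasDerivAt_integral] with s h1 h2 hs
    have h3 := h1 hs
    have h4 : HasDerivAt ell (w s) s := h2 (by rwa [u01]) 0 (by simp)
    have hτd : HasDerivAt τ (α / M * w s) s := (h4.const_mul _).add_const _
    have dx : HasDerivAt (fun s => (γ s).1) (a s) s := h3.fst
    have dy : HasDerivAt (fun s => (γ s).2.1) (b s) s := h3.snd.fst
    have dt : HasDerivAt (fun s => (γ s).2.2) (2 * (γ s).2.1 * a s - 2 * (γ s).1 * b s) s := h3.snd.snd
    have hsp := hsin _ (hτm s hs)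
    have dX := dx.sub_const 1
    have dG := (h4.const_mul M).fun_sub ((((hτd.cos.fun_div hτd.sin hsp.ne').fun_mul
      ((dX.fun_mul dX).fun_add (dy.fun_mul dy))).fun_add (dt.fun_add (dy.const_mul 2))).const_mul α)
    have hdG : deriv G s = _ := dG.deriv
    rw [hdG]
    have key := calib_pt M α (a s) (b s) (w s) ((γ s).1 - 1) (γ s).2.1 (Real.sin (τ s)) (Real.cos (τ s))
      hM0 hsp (Real.sin_sq_add_cos_sq _) (hw0 s) hα (Real.sq_sqrt (by positivity))
    have e1 : (-Real.sin (τ s) * (α / M * w s) * Real.sin (τ s) - Real.cos (τ s) * (Real.cos (τ s) * (α / M * w s)))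
       / Real.sin (τ s) ^ 2 = - ((α * w s / M) / Real.sin (τ s) ^ 2) := by
      have := Real.sin_sq_add_cos_sq (τ s)
      field_simp
      linear_combination (-(w s)) * this
    rw [e1]
    refine sub_nonneg.2 (le_trans (le_of_eq ?_) key)
    ring
  have hint : 0 ≤ ∫ s in (0:ℝ)..1, deriv G s := by
    rw [intervalIntegral.integral_of_le zero_le_one]
    apply setIntegral_nonneg_of_ae_restrict
    rw [Filter.EventuallyLE, ae_restrict_iff' measurableSet_Ioc]
    filter_upwards [hG'] with s hs hs'
    exact hs (Set.Ioc_subset_Icc_self hs')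
  rw [acG.integral_deriv_eq_sub] at hint
  have hell0 : ell 0 = 0 := by simp [hell]
  simp only [hG, h0, h1, hell0] at hint
  have m1 := hτm 1 (by simp)
  have hcot : Real.cos (α + δ) / Real.sin (α + δ) ≤ Real.cos (τ 1) / Real.sin (τ 1) := by
    have s1 := hsin _ m1
    have s2 := hsin (α + δ) ⟨by linarith, le_rfl⟩
    rw [div_le_div_iff₀ s2 s1]
    have : 0 ≤ Real.sin (α + δ - τ 1) :=
      Real.sin_nonneg_of_nonneg_of_le_pi (by linarith [m1.2]) (by linarith [m1.1])
    rw [Real.sin_sub] at this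
    linarith
  have hc1 := Real.cos_le_one θ
  have hsc := Real.sin_sq_add_cos_sq θ
  have hbase : (Real.cos θ - 1) * (Real.cos θ - 1) + Real.sin θ * Real.sin θ = 2 - 2 * Real.cos θ := by
    linear_combination hsc
  rw [hbase] at hint
  have := mul_le_mul_of_nonneg_right hcot (show 0 ≤ 2 - 2 * Real.cos θ by linarith)
  have h5 := mul_le_mul_of_nonneg_left this hα.le
  have h6 := mul_le_mul_of_nonneg_left hell1.le hM0.le
  nlinarith

def lenSet (θ : ℝ) : Set ℝ := { L : ℝ | ∃ (γ : ℝ → H) (a b : ℝ → ℝ) (K : NNReal),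
    LipschitzWith K γ ∧ γ 0 = (1, 0, 0) ∧ γ 1 = (Real.cos θ, Real.sin θ, 0) ∧
    (∀ᵐ s ∂volume, s ∈ Set.Icc (0:ℝ) 1 →
      HasDerivAt γ (a s, b s, 2 * (γ s).2.1 * a s - 2 * (γ s).1 * b s) s) ∧
    IntervalIntegrable (fun s => Real.sqrt (a s ^ 2 + b s ^ 2)) volume 0 1 ∧
    L = ∫ s in (0:ℝ)..1, Real.sqrt (a s ^ 2 + b s ^ 2) }

theorem rho_def (θ : ℝ) : rho θ = sInf (lenSet θ) := rfl

theorem lenSet_nonneg (θ : ℝ) : ∀ L ∈ lenSet θ, 0 ≤ L := by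
  rintro L ⟨γ, a, b, K, -, -, -, -, -, rfl⟩
  exact intervalIntegral.integral_nonneg zero_le_one fun u _ => Real.sqrt_nonneg _

theorem rho_nonneg (θ : ℝ) : 0 ≤ rho θ := Real.sInf_nonneg (lenSet_nonneg θ)

theorem rho_le {θ L : ℝ} (h : L ∈ lenSet θ) : rho θ ≤ L :=
  csInf_le ⟨0, fun _ h => lenSet_nonneg θ _ h⟩ h

theorem rho_zero : rho 0 = 0 := by
  apply le_antisymm _ (rho_nonneg 0)
  apply rho_le
  refine ⟨fun _ => (1, 0, 0), fun _ => 0, fun _ => 0, 0, LipschitzWith.const _, rfl, by simp, ?_, ?_, ?_⟩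
  · filter_upwards with s _
    have := hasDerivAt_const s ((1, 0, 0) : H)
    convert! this using 1
    simp
  · simp
  · simp

theorem lip_aux {f f' : ℝ → ℝ} {C : ℝ} (hf : ∀ s, HasDerivAt f (f' s) s) (hb : ∀ s, |f' s| ≤ C) :
    ∃ K, LipschitzWith K f := by
  refine ⟨C.toNNReal, lipschitzWith_of_nnnorm_deriv_le (fun s => (hf s).differentiableAt) fun s => ?_⟩
  rw [(hf s).deriv, ← NNReal.coe_le_coe, coe_nnnorm, Real.norm_eq_abs]
  exact (hb s).trans (Real.le_coe_toNNReal C)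

theorem neg_sub_lenSet (θ : ℝ) : lenSet θ ⊆ lenSet (-θ) := by
  rintro L ⟨γ, a, b, K, hK, h0, h1, hd, hi, rfl⟩
  have l1 := LipschitzWith.prod_fst.comp hK
  have l2 := (LipschitzWith.prod_fst.comp (LipschitzWith.prod_snd.comp hK)).neg
  have l3 := (LipschitzWith.prod_snd.comp (LipschitzWith.prod_snd.comp hK)).neg
  refine ⟨fun s => ((γ s).1, -(γ s).2.1, -(γ s).2.2), a, fun s => - b s, _, l1.prodMk (l2.prodMk l3),
    ?_, ?_, ?_, ?_, ?_⟩
  · simp [h0]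
  · simp [h1]
  · filter_upwards [hd] with s h hs
    have h3 := h hs
    have dx : HasDerivAt (fun s => (γ s).1) (a s) s := h3.fst
    have dy : HasDerivAt (fun s => (γ s).2.1) (b s) s := h3.snd.fst
    have dt : HasDerivAt (fun s => (γ s).2.2) (2 * (γ s).2.1 * a s - 2 * (γ s).1 * b s) s := h3.snd.snd
    convert! dx.prodMk (dy.fun_neg.prodMk dt.fun_neg) using 3
    ring
  · simpa using hi
  · simp

theorem rho_neg (θ : ℝ) : rho (-θ) = rho θ := by
  rw [rho_def, rho_def]
  congr 1
  refine Set.Subset.antisymm ?_ (neg_sub_lenSet θ)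
  simpa using neg_sub_lenSet (-θ)

theorem arc_mem {θ α : ℝ} (hα : 0 < α) (hα' : α < Real.pi) (hθ : 0 < θ) (hθ' : θ < Real.pi)
    (hh : Real.cos (θ / 2) * Real.sin α ^ 2 = (α - Real.sin α * Real.cos α) * Real.sin (θ / 2)) :
    2 * Real.sin (θ / 2) * α / Real.sin α ∈ lenSet θ := by
  have hs : 0 < Real.sin α := Real.sin_pos_of_pos_of_lt_pi hα hα'
  have hu : 0 < Real.sin (θ / 2) := Real.sin_pos_of_pos_of_lt_pi (by linarith) (by linarith)
  have ct : Real.cos θ = Real.cos (θ/2)^2 - Real.sin (θ/2)^2 := by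
    rw [← Real.cos_two_mul', mul_div_cancel₀ _ two_ne_zero]
  have st : Real.sin θ = 2 * Real.sin (θ/2) * Real.cos (θ/2) := by
    rw [← Real.sin_two_mul, mul_div_cancel₀ _ two_ne_zero]
  have sc := Real.sin_sq_add_cos_sq (θ / 2)
  set su := Real.sin (θ / 2)
  set cu := Real.cos (θ / 2)
  obtain ⟨r, hr⟩ : ∃ r, r = su / Real.sin α := ⟨_, rfl⟩
  have hrs : r * Real.sin α = su := by rw [hr]; field_simp
  have hr0 : 0 < r := by rw [hr]; positivity
  obtain ⟨q, hq⟩ : ∃ q, q = cu + r * Real.cos α := ⟨_, rfl⟩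
  have hqs : q * Real.sin α = r * α := by
    have : (q * Real.sin α - r * α) * Real.sin α = 0 := by
      rw [hq]; linear_combination hh + (Real.sin α * Real.cos α - α) * hrs
    rcases mul_eq_zero.1 this with h | h
    · linarith
    · exact absurd h hs.ne'
  have dω : ∀ s, HasDerivAt (fun s : ℝ => α * (1 - 2 * s)) (-2 * α) s := fun s => by
    have := (((hasDerivAt_id' s).const_mul 2).const_sub 1).const_mul α
    convert! this using 1; ring
  let x : ℝ → ℝ := fun s => cu * (q - r * Real.cos (α * (1 - 2 * s))) + su * (r * Real.sin (α * (1 - 2 * s)))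
  let y : ℝ → ℝ := fun s => su * (q - r * Real.cos (α * (1 - 2 * s))) - cu * (r * Real.sin (α * (1 - 2 * s)))
  let t : ℝ → ℝ := fun s => (-2 * r * q) * (Real.sin α - Real.sin (α * (1 - 2 * s))) + 4 * α * r ^ 2 * s
  let a : ℝ → ℝ := fun s => -2 * α * r * (cu * Real.sin (α * (1 - 2 * s)) + su * Real.cos (α * (1 - 2 * s)))
  let b : ℝ → ℝ := fun s => -2 * α * r * (su * Real.sin (α * (1 - 2 * s)) - cu * Real.cos (α * (1 - 2 * s)))
  let t' : ℝ → ℝ := fun s => -4 * α * r * (q * Real.cos (α * (1 - 2 * s)) - r)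
  have dx : ∀ s, HasDerivAt x (a s) s := fun s => by
    have := (((dω s).cos.const_mul r).const_sub q |>.const_mul cu).fun_add (((dω s).sin.const_mul r).const_mul su)
    convert! this using 1; simp only [a]; ring
  have dy : ∀ s, HasDerivAt y (b s) s := fun s => by
    have := (((dω s).cos.const_mul r).const_sub q |>.const_mul su).fun_sub (((dω s).sin.const_mul r).const_mul cu)
    convert! this using 1; simp only [b]; ring
  have dt : ∀ s, HasDerivAt t (t' s) s := fun s => by
    have := ((dω s).sin.const_sub (Real.sin α) |>.const_mul (-2 * r * q)).fun_add ((hasDerivAt_id' s).const_mul (4 * α * r ^ 2))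
    convert! this using 1; simp only [t']; ring
  have hab : ∀ s, a s ^ 2 + b s ^ 2 = (2 * α * r) ^ 2 := fun s => by
    have := Real.sin_sq_add_cos_sq (α * (1 - 2 * s))
    simp only [a, b]
    linear_combination (4 * α ^ 2 * r ^ 2 * (Real.sin (α * (1 - 2 * s)) ^ 2 + Real.cos (α * (1 - 2 * s)) ^ 2)) * sc
      + 4 * α ^ 2 * r ^ 2 * this
  have hsq : ∀ s, Real.sqrt (a s ^ 2 + b s ^ 2) = 2 * α * r := fun s => by
    rw [hab, Real.sqrt_sq (by positivity)]
  obtain ⟨K1, l1⟩ := lip_aux (C := 2 * α * r) dx (fun s => abs_le_of_sq_le_sq (by rw [← hab s]; nlinarith [sq_nonneg (b s)]) (by positivity))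
  obtain ⟨K2, l2⟩ := lip_aux (C := 2 * α * r) dy (fun s => abs_le_of_sq_le_sq (by rw [← hab s]; nlinarith [sq_nonneg (a s)]) (by positivity))
  obtain ⟨K3, l3⟩ := lip_aux (C := 4 * α * r * (|q| + r)) dt (fun s => by
    simp only [t']
    rw [abs_mul, show |-4 * α * r| = 4 * α * r by rw [abs_of_neg] <;> nlinarith [mul_pos hα hr0]]
    gcongr
    refine (abs_sub _ _).trans ?_
    rw [abs_mul, abs_of_pos hr0]
    have := mul_le_mul_of_nonneg_left (Real.abs_cos_le_one (α * (1 - 2 * s))) (abs_nonneg q)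
    linarith)
  refine ⟨fun s => (x s, y s, t s), a, b, _, l1.prodMk (l2.prodMk l3), ?_, ?_, ?_, ?_, ?_⟩
  · simp only [x, y, t, Prod.mk.injEq]
    simp only [mul_zero, sub_zero, mul_one, sub_self, add_zero]
    refine ⟨?_, ?_, trivial⟩
    · rw [hrs, hq]; linear_combination sc
    · rw [hrs, hq]; ring
  · simp only [x, y, t, Prod.mk.injEq]
    rw [show α * (1 - 2 * 1) = -α by ring, Real.sin_neg, Real.cos_neg, ct, st]
    refine ⟨?_, ?_, ?_⟩
    · rw [hq]; linear_combination (-su) * hrs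
    · rw [hq]; linear_combination cu * hrs
    · linear_combination (-4 * r) * hqs
  · filter_upwards with s _
    convert! (dx s).prodMk ((dy s).prodMk (dt s)) using 3
    have := Real.sin_sq_add_cos_sq (α * (1 - 2 * s))
    simp only [x, y, a, b, t']
    linear_combination (-4 * α * r * (q * Real.cos (α * (1 - 2 * s)) - r * (Real.sin (α * (1 - 2 * s)) ^ 2 + Real.cos (α * (1 - 2 * s)) ^ 2))) * sc
      + 4 * α * r ^ 2 * this
  · simp only [hsq]; simp
  · simp only [hsq]; rw [hr]; simp; ring

theorem rho_eq {θ α : ℝ} (hα : 0 < α) (hα' : α < Real.pi) (hθ : 0 < θ) (hθ' : θ < Real.pi)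
    (hh : Real.cos (θ / 2) * Real.sin α ^ 2 = (α - Real.sin α * Real.cos α) * Real.sin (θ / 2)) :
    rho θ = 2 * Real.sin (θ / 2) * α / Real.sin α := by
  have hmem := arc_mem hα hα' hθ hθ' hh
  apply le_antisymm (rho_le hmem)
  apply le_of_forall_gt_imp_ge_of_dense
  intro M hM
  have hM0 : 0 < M := (rho_nonneg θ).trans_lt hM
  have hs : 0 < Real.sin α := Real.sin_pos_of_pos_of_lt_pi hα hα'
  have hu : 0 < Real.sin (θ / 2) := Real.sin_pos_of_pos_of_lt_pi (by linarith) (by linarith)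
  have ct : Real.cos θ = 1 - 2 * Real.sin (θ/2)^2 := by
    have h1 := Real.cos_sq' (θ / 2)
    have h2 := Real.cos_two_mul (θ / 2)
    rw [mul_div_cancel₀ _ two_ne_zero] at h2
    linarith
  have st : Real.sin θ = 2 * Real.sin (θ/2) * Real.cos (θ/2) := by
    rw [← Real.sin_two_mul, mul_div_cancel₀ _ two_ne_zero]
  have hlim : Filter.Tendsto (fun δ : ℝ => α * (Real.cos (α + δ) / Real.sin (α + δ) * (2 - 2 * Real.cos θ) + 2 * Real.sin θ))
      (nhdsWithin 0 (Set.Ioi 0)) (nhds (α * (Real.cos (α + 0) / Real.sin (α + 0) * (2 - 2 * Real.cos θ) + 2 * Real.sin θ))) := by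
    apply Filter.Tendsto.mono_left _ nhdsWithin_le_nhds
    have : ContinuousAt (fun δ : ℝ => α * (Real.cos (α + δ) / Real.sin (α + δ) * (2 - 2 * Real.cos θ) + 2 * Real.sin θ)) 0 := by
      have : Real.sin (α + 0) ≠ 0 := by simpa using hs.ne'
      fun_prop (disch := assumption)
    exact this
  have hle := le_of_tendsto hlim (b := M ^ 2) (by
    filter_upwards [Ioo_mem_nhdsGT (show (0:ℝ) < Real.pi - α by linarith)] with δ hδ
    exact calib_s13 M α δ θ hα hδ.1 (by linarith [hδ.2]) hM hM0 ⟨_, hmem⟩)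
  refine le_of_abs_le (abs_le_of_sq_le_sq (le_trans (le_of_eq ?_) hle) hM0.le)
  rw [add_zero, ct, st]
  field_simp
  linear_combination (-2 * Real.sin (θ / 2)) * hh

theorem mul_cos_le_sin {α : ℝ} (h0 : 0 < α) (h1 : α < Real.pi) : α * Real.cos α ≤ Real.sin α := by
  have hs : 0 < Real.sin α := Real.sin_pos_of_pos_of_lt_pi h0 h1
  rcases lt_or_ge α (Real.pi / 2) with h | h
  · have hc : 0 < Real.cos α := Real.cos_pos_of_mem_Ioo ⟨by linarith, h⟩
    have := Real.lt_tan h0 h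
    rw [Real.tan_eq_sin_div_cos, lt_div_iff₀ hc] at this
    exact this.le
  · have hc : Real.cos α ≤ 0 := Real.cos_nonpos_of_pi_div_two_le_of_le h (by linarith)
    nlinarith

def hf (α : ℝ) : ℝ := α / Real.sin α ^ 2 - Real.cos α / Real.sin α

theorem hf_deriv {α : ℝ} (hs : 0 < Real.sin α) :
    HasDerivAt hf (2 * (Real.sin α - α * Real.cos α) / Real.sin α ^ 3) α := by
  have h1 := (hasDerivAt_id' α).fun_div ((Real.hasDerivAt_sin α).fun_pow 2) (pow_ne_zero 2 hs.ne')
  have h2 := (Real.hasDerivAt_cos α).fun_div (Real.hasDerivAt_sin α) hs.ne'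
  have := h1.fun_sub h2
  convert! this using 1
  have sc := Real.sin_sq_add_cos_sq α
  field_simp
  push_cast
  linear_combination (-Real.sin α ^ 2) * sc

def Pf (α : ℝ) : ℝ := 4 * (α ^ 2 / Real.sin α ^ 2) / (1 + hf α ^ 2)

theorem Pf_deriv {α : ℝ} (hs : 0 < Real.sin α) :
    HasDerivAt Pf (-4 * (2 * (Real.sin α - α * Real.cos α) / Real.sin α ^ 3) * α * (α ^ 2 - Real.sin α ^ 2)
      / Real.sin α ^ 4 / (1 + hf α ^ 2) ^ 2) α := by
  have h1 := (((hasDerivAt_id' α).fun_pow 2).fun_div ((Real.hasDerivAt_sin α).fun_pow 2)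
    (pow_ne_zero 2 hs.ne')).const_mul 4
  have hp : 1 + hf α ^ 2 ≠ 0 := by positivity
  have h2 := ((hf_deriv hs).fun_pow 2).const_add 1
  have := h1.fun_div h2 hp
  convert! this using 1
  rw [div_left_inj' (by positivity)]
  have sc := Real.sin_sq_add_cos_sq α
  have hc2 : Real.cos α ^ 2 = 1 - Real.sin α ^ 2 := by linarith
  simp only [hf, Nat.cast_ofNat, show (2 - 1 : ℕ) = 1 from rfl, pow_one]
  field_simp
  ring_nf
  simp only [hc2, show Real.cos α ^ 3 = Real.cos α * (1 - Real.sin α ^ 2) by rw [← hc2]; ring]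
  ring

theorem D_anti {l : ℝ} (hl : 0 < l) :
    AntitoneOn (fun α => Pf α - (l - Real.sin l) * (Real.pi - 2 * Real.arctan (hf α))) (Set.Ico l Real.pi) := by
  have hd : ∀ α, 0 < Real.sin α → HasDerivAt (fun α => Pf α - (l - Real.sin l) * (Real.pi - 2 * Real.arctan (hf α))) _ α :=
    fun α hs => (Pf_deriv hs).fun_sub ((((hf_deriv hs).arctan.const_mul 2).const_sub Real.pi).const_mul (l - Real.sin l))
  have hpos : ∀ α ∈ Set.Ico l Real.pi, 0 < Real.sin α := fun α h =>
    Real.sin_pos_of_pos_of_lt_pi (by linarith [h.1]) h.2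
  apply antitoneOn_of_deriv_nonpos (convex_Ico _ _)
  · exact fun α h => (hd α (hpos α h)).continuousAt.continuousWithinAt
  · exact fun α h => (hd α (hpos α (interior_subset h))).differentiableAt.differentiableWithinAt
  · intro α h
    have h := interior_subset h
    have hs := hpos α h
    have hα : 0 < α := by linarith [h.1]
    rw [(hd α hs).deriv]
    have hk : l - Real.sin l ≤ α - Real.sin α := by
      have := Real.lipschitzWith_sin.dist_le_mul α l
      rw [Real.dist_eq, Real.dist_eq, abs_of_nonneg (show 0 ≤ α - l by linarith [h.1])] at this
      have := le_of_abs_le this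
      simp at this
      linarith
    have hsα : Real.sin α < α := Real.sin_lt hα
    have hC : 0 < l - Real.sin l := sub_pos.2 (Real.sin_lt hl)
    have hm := mul_cos_le_sin hα h.2
    set C := l - Real.sin l
    have hQ : (1 + hf α ^ 2) * Real.sin α ^ 4 = α ^ 2 + Real.sin α ^ 2 - 2 * α * Real.sin α * Real.cos α := by
      have sc := Real.sin_sq_add_cos_sq α
      simp only [hf]
      field_simp
      linear_combination (Real.sin α ^ 2) * sc
    have hcm := Real.neg_one_le_cos α
    have hQ2 : (1 + hf α ^ 2) * Real.sin α ^ 4 ≤ (α + Real.sin α) ^ 2 := by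
      rw [hQ]; nlinarith [mul_pos hα hs]
    have hmain : C * ((1 + hf α ^ 2) * Real.sin α ^ 4) ≤ 2 * α * (α ^ 2 - Real.sin α ^ 2) := by
      calc C * ((1 + hf α ^ 2) * Real.sin α ^ 4) ≤ (α - Real.sin α) * (α + Real.sin α) ^ 2 := by
            gcongr
        _ = ((α - Real.sin α) * (α + Real.sin α)) * (α + Real.sin α) := by ring
        _ ≤ ((α - Real.sin α) * (α + Real.sin α)) * (2 * α) := by
            apply mul_le_mul_of_nonneg_left (by linarith)
            apply mul_nonneg <;> linarith
        _ = _ := by ring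
    have hw : 0 < 1 + hf α ^ 2 := by positivity
    set W := 1 + hf α ^ 2
    set k := 2 * (Real.sin α - α * Real.cos α) / Real.sin α ^ 3 with hkdef
    have hk0 : 0 ≤ k := by
      have : 0 ≤ Real.sin α - α * Real.cos α := by linarith
      positivity
    have : -4 * k * α * (α ^ 2 - Real.sin α ^ 2) / Real.sin α ^ 4 / W ^ 2 - C * -(2 * (1 / W * k)) =
      -(2 * k * (2 * α * (α ^ 2 - Real.sin α ^ 2) - C * (W * Real.sin α ^ 4)) / (Real.sin α ^ 4 * W ^ 2)) := by
      field_simp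
      ring
    rw [this, neg_nonpos]
    have := sub_nonneg.2 hmain
    positivity

theorem hf_mono : MonotoneOn hf (Set.Ioo 0 Real.pi) := by
  have hpos : ∀ α ∈ Set.Ioo 0 Real.pi, 0 < Real.sin α := fun α h =>
    Real.sin_pos_of_pos_of_lt_pi h.1 h.2
  apply monotoneOn_of_deriv_nonneg (convex_Ioo _ _)
  · exact fun α h => (hf_deriv (hpos α h)).continuousAt.continuousWithinAt
  · exact fun α h => (hf_deriv (hpos α (interior_subset h))).differentiableAt.differentiableWithinAt
  · intro α h
    have h := interior_subset h
    have hs := hpos α h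
    rw [(hf_deriv hs).deriv]
    have := sub_nonneg.2 (mul_cos_le_sin h.1 h.2)
    positivity

theorem exists_alpha {u : ℝ} (h0 : 0 < u) (h1 : u < Real.pi / 2) :
    ∃ α ∈ Set.Icc (Real.pi / 2 - u) (Real.pi - u), hf α = Real.cos u / Real.sin u := by
  have hpi := Real.pi_pos
  have hsu : 0 < Real.sin u := Real.sin_pos_of_pos_of_lt_pi h0 (by linarith)
  have hcu : 0 < Real.cos u := Real.cos_pos_of_mem_Ioo ⟨by linarith, h1⟩
  have hc : ContinuousOn hf (Set.Icc (Real.pi / 2 - u) (Real.pi - u)) := fun α h =>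
    (hf_deriv (Real.sin_pos_of_pos_of_lt_pi (by linarith [h.1]) (by linarith [h.2]))).continuousAt.continuousWithinAt
  apply intermediate_value_Icc (by linarith) hc
  constructor
  · have := mul_cos_le_sin (α := Real.pi / 2 - u) (by linarith) (by linarith)
    simp only [hf]
    rw [Real.sin_pi_div_two_sub, Real.cos_pi_div_two_sub] at *
    have sc := Real.sin_sq_add_cos_sq u
    have e : Real.cos u / Real.sin u - ((Real.pi / 2 - u) / Real.cos u ^ 2 - Real.sin u / Real.cos u)
      = (Real.cos u - (Real.pi / 2 - u) * Real.sin u) / (Real.sin u * Real.cos u ^ 2) := by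
      field_simp
      first | linear_combination (2 * Real.cos u) * sc | linear_combination sc
    have : 0 ≤ (Real.cos u - (Real.pi / 2 - u) * Real.sin u) / (Real.sin u * Real.cos u ^ 2) := by
      have := sub_nonneg.2 this
      positivity
    linarith
  · simp only [hf]
    rw [Real.sin_pi_sub, Real.cos_pi_sub, neg_div, sub_neg_eq_add]
    have : 0 ≤ (Real.pi - u) / Real.sin u ^ 2 := by
      have : 0 ≤ Real.pi - u := by linarith
      positivity
    linarith

theorem rho_param {θ : ℝ} (h0 : 0 < θ) (h1 : θ < Real.pi) :
    ∃ α, Real.pi / 2 - θ / 2 ≤ α ∧ α < Real.pi ∧ rho θ ^ 2 = Pf α ∧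
      θ = Real.pi - 2 * Real.arctan (hf α) ∧ 2 * Real.sin (θ / 2) ≤ rho θ ∧ rho θ ≤ 2 := by
  obtain ⟨α, hα, he⟩ := exists_alpha (u := θ / 2) (by linarith) (by linarith)
  have hpi := Real.pi_pos
  have hα0 : 0 < α := by linarith [hα.1]
  have hα1 : α < Real.pi := by linarith [hα.2]
  have hs := Real.sin_pos_of_pos_of_lt_pi hα0 hα1
  have hsu : 0 < Real.sin (θ / 2) := Real.sin_pos_of_pos_of_lt_pi (by linarith) (by linarith)
  have sc := Real.sin_sq_add_cos_sq α
  have scu := Real.sin_sq_add_cos_sq (θ / 2)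
  have hh : Real.cos (θ / 2) * Real.sin α ^ 2 = (α - Real.sin α * Real.cos α) * Real.sin (θ / 2) := by
    simp only [hf] at he
    field_simp at he
    linarith
  have hr := rho_eq hα0 hα1 h0 h1 hh
  have hP : rho θ ^ 2 = Pf α := by
    rw [hr, Pf, he]
    have : 1 + (Real.cos (θ / 2) / Real.sin (θ / 2)) ^ 2 = 1 / Real.sin (θ / 2) ^ 2 := by
      field_simp; exact scu
    rw [this]
    field_simp
    norm_num
  refine ⟨α, hα.1, hα1, hP, ?_, ?_, ?_⟩
  · have ht : Real.cos (θ / 2) / Real.sin (θ / 2) = Real.tan (Real.pi / 2 - θ / 2) := by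
      rw [Real.tan_eq_sin_div_cos, Real.sin_pi_div_two_sub, Real.cos_pi_div_two_sub]
    rw [he, ht, Real.arctan_tan (by linarith) (by linarith)]
    ring
  · rw [hr, le_div_iff₀ hs]
    have := (Real.sin_lt hα0).le
    gcongr
  · refine le_of_abs_le (abs_le_of_sq_le_sq ?_ (by norm_num))
    rw [hP, Pf, div_le_iff₀ (by positivity)]
    have e : 2 ^ 2 * (1 + hf α ^ 2) - 4 * (α ^ 2 / Real.sin α ^ 2) =
      4 * (α * Real.cos α - Real.sin α) ^ 2 / Real.sin α ^ 4 := by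
      simp only [hf]
      field_simp
      linear_combination (4 * Real.sin α ^ 2 - 4 * α ^ 2) * sc
    have : 0 ≤ 4 * (α * Real.cos α - Real.sin α) ^ 2 / Real.sin α ^ 4 := by positivity
    linarith

theorem mono_bound {l : ℝ} (hl : 0 < l) (hl' : l < Real.pi) {θ φ : ℝ} (h0 : 0 ≤ φ) (h1 : φ < θ)
    (h2 : θ ≤ Real.pi - l) :
    min ((l / 2 - Real.sin (l / 2)) / 4) (1 / 2) * (θ - φ) ≤ rho θ - rho φ := by
  have hC : 0 < l / 2 - Real.sin (l / 2) := sub_pos.2 (Real.sin_lt (by linarith))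
  have hpi := Real.pi_pos
  obtain ⟨α, a1, a2, a3, a4, a5, a6⟩ := rho_param (θ := θ) (by linarith) (by linarith)
  rcases h0.eq_or_lt with rfl | h0
  · rw [rho_zero]
    have : 2 / Real.pi * (θ / 2) ≤ Real.sin (θ / 2) := Real.mul_le_sin (by linarith) (by linarith)
    have h4 : 1 / 2 ≤ 2 / Real.pi := by
      rw [div_le_div_iff₀ (by norm_num) hpi]; linarith [Real.pi_le_four]
    have h5 := mul_le_mul_of_nonneg_right h4 (show 0 ≤ θ / 2 by linarith)
    have h6 := mul_le_mul_of_nonneg_right (min_le_right ((l / 2 - Real.sin (l / 2)) / 4) (1 / 2)) (show 0 ≤ θ - 0 by linarith)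
    linarith
  · obtain ⟨β, b1, b2, b3, b4, b5, b6⟩ := rho_param (θ := φ) (by linarith) (by linarith)
    have hab : α ≤ β := by
      by_contra hcon
      push Not at hcon
      have := hf_mono ⟨by linarith, b2⟩ ⟨by linarith, a2⟩ hcon.le
      have := Real.arctan_mono this
      linarith
    have hD := D_anti (l := l / 2) (by linarith) ⟨by linarith, a2⟩ ⟨by linarith, b2⟩ hab
    simp only at hD
    rw [← a3, ← b3, ← a4, ← b4] at hD
    have hdiff : (l / 2 - Real.sin (l / 2)) * (θ - φ) ≤ (rho θ - rho φ) * (rho θ + rho φ) := by nlinarith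
    have hn1 := rho_nonneg φ
    have hn2 := rho_nonneg θ
    have hpp : 0 < (l / 2 - Real.sin (l / 2)) * (θ - φ) := mul_pos hC (by linarith)
    have hge : 0 ≤ rho θ - rho φ := by
      by_contra hcon
      push Not at hcon
      nlinarith
    have h6 := mul_le_mul_of_nonneg_right (min_le_left ((l / 2 - Real.sin (l / 2)) / 4) (1 / 2)) (show 0 ≤ θ - φ by linarith)
    nlinarith

/-- biLipschitz lower bound for `ρ` away from `θ = ±π`.
For every `λ ∈ (0,π)` there is `C'_λ > 0` such that
`|ρ(θ) − ρ(φ)| ≥ C'_λ |θ − |φ||` for all `θ ∈ [0, π−λ]` and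
`φ ∈ [−π+λ, π−λ]`. -/
theorem statement13 :
    ∀ l : ℝ, l ∈ Set.Ioo 0 Real.pi → ∃ C > (0:ℝ),
      ∀ θ ∈ Set.Icc (0:ℝ) (Real.pi - l),
      ∀ φ ∈ Set.Icc (-Real.pi + l) (Real.pi - l),
        C * abs (θ - abs φ) ≤ abs (rho θ - rho φ) := by
  intro l hl
  have hC : 0 < l / 2 - Real.sin (l / 2) := sub_pos.2 (Real.sin_lt (by linarith [hl.1]))
  refine ⟨min ((l / 2 - Real.sin (l / 2)) / 4) (1 / 2), by positivity, ?_⟩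
  intro θ hθ φ hφ
  have hphi : rho φ = rho |φ| := by
    rcases abs_choice φ with h | h
    · rw [h]
    · rw [h, rho_neg]
  have hab : |φ| ≤ Real.pi - l := abs_le.2 ⟨by linarith [hφ.1], hφ.2⟩
  rw [hphi]
  rcases lt_trichotomy θ |φ| with h | h | h
  · have := mono_bound hl.1 hl.2 hθ.1 h hab
    rw [abs_sub_comm θ, abs_sub_comm (rho θ), abs_of_pos (sub_pos.2 h)]
    exact this.trans (le_abs_self _)
  · rw [← h]; simp
  · have := mono_bound hl.1 hl.2 (abs_nonneg φ) h hθ.2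
    rw [abs_of_pos (sub_pos.2 h)]
    exact this.trans (le_abs_self _)
end
end

section
/- There exist constants C₀ ≥ C₁ > 0 such that C₁ √θ ≤ ρ(θ) ≤ C₀ √θ for all θ ∈ [0,π]. -/
noncomputable section

open MeasureTheory

lemma lip_bound {f f' g : ℝ → ℝ} {K : NNReal} (hf : LipschitzWith K f)
    (hd : ∀ᵐ s ∂volume, s ∈ Set.Icc (0:ℝ) 1 → HasDerivAt f (f' s) s)
    (hb : ∀ s ∈ Set.Icc (0:ℝ) 1, |f' s| ≤ g s)
    (hg : IntervalIntegrable g volume 0 1) {s : ℝ} (hs : s ∈ Set.Icc (0:ℝ) 1) :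
    |f s - f 0| ≤ ∫ x in (0:ℝ)..1, g x := by
  have hac : AbsolutelyContinuousOnInterval f 0 s :=
    (hf.lipschitzOnWith (s := Set.uIcc 0 s)).absolutelyContinuousOnInterval
  have hsub : Set.uIcc (0:ℝ) s ⊆ Set.uIcc 0 1 := by
    rw [Set.uIcc_of_le hs.1, Set.uIcc_of_le zero_le_one]
    exact Set.Icc_subset_Icc le_rfl hs.2
  have h1 : ‖∫ x in (0:ℝ)..s, deriv f x‖ ≤ ∫ x in (0:ℝ)..s, g x := by
    refine intervalIntegral.norm_integral_le_of_norm_le hs.1 ?_ (hg.mono_set hsub)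
    filter_upwards [hd] with x hx hx'
    have hxI : x ∈ Set.Icc (0:ℝ) 1 := ⟨hx'.1.le, hx'.2.trans hs.2⟩
    rw [(hx hxI).deriv]
    exact hb x hxI
  rw [hac.integral_deriv_eq_sub, Real.norm_eq_abs] at h1
  refine h1.trans ?_
  refine intervalIntegral.integral_mono_interval le_rfl hs.1 hs.2 ?_ hg
  rw [Filter.EventuallyLE, ae_restrict_iff' measurableSet_Ioc]
  refine Filter.Eventually.of_forall fun x hx => ?_
  exact (abs_nonneg _).trans (hb x ⟨hx.1.le, hx.2⟩)

lemma abs_le_speed_left (a b : ℝ) : |a| ≤ Real.sqrt (a ^ 2 + b ^ 2) :=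
  Real.abs_le_sqrt (by nlinarith [sq_nonneg b])

lemma abs_le_speed_right (a b : ℝ) : |b| ≤ Real.sqrt (a ^ 2 + b ^ 2) :=
  Real.abs_le_sqrt (by nlinarith [sq_nonneg a])

lemma speed_le (a b : ℝ) : Real.sqrt (a ^ 2 + b ^ 2) ≤ |a| + |b| := by
  rw [Real.sqrt_le_left (by positivity)]
  nlinarith [sq_abs a, sq_abs b, abs_nonneg a, abs_nonneg b, mul_nonneg (abs_nonneg a) (abs_nonneg b)]

lemma lower_aux {θ L : ℝ} (γ : ℝ → H) (a b : ℝ → ℝ) (K : NNReal)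
    (hL : LipschitzWith K γ) (h0 : γ 0 = (1, 0, 0)) (h1 : γ 1 = (Real.cos θ, Real.sin θ, 0))
    (hd : ∀ᵐ s ∂volume, s ∈ Set.Icc (0:ℝ) 1 →
      HasDerivAt γ (a s, b s, 2 * (γ s).2.1 * a s - 2 * (γ s).1 * b s) s)
    (hi : IntervalIntegrable (fun s => Real.sqrt (a s ^ 2 + b s ^ 2)) volume 0 1)
    (hLe : L = ∫ s in (0:ℝ)..1, Real.sqrt (a s ^ 2 + b s ^ 2)) :
    0 ≤ L ∧ 1 - Real.cos θ ≤ L ∧ Real.sin θ ≤ 2 * L ^ 2 := by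
  have I1 : (1:ℝ) ∈ Set.Icc (0:ℝ) 1 := by simp
  have lx : LipschitzWith (1 * K) (fun s => (γ s).1) := LipschitzWith.prod_fst.comp hL
  have l2 : LipschitzWith (1 * K) (fun s => (γ s).2) := LipschitzWith.prod_snd.comp hL
  have ly : LipschitzWith (1 * (1 * K)) (fun s => (γ s).2.1) := LipschitzWith.prod_fst.comp l2
  have lt : LipschitzWith (1 * (1 * K)) (fun s => (γ s).2.2) := LipschitzWith.prod_snd.comp l2
  have dx : ∀ᵐ s ∂volume, s ∈ Set.Icc (0:ℝ) 1 → HasDerivAt (fun s => (γ s).1) (a s) s := by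
    filter_upwards [hd] with s hs hI
    exact (hasFDerivAt_fst (𝕜 := ℝ) (p := γ s)).comp_hasDerivAt s (hs hI)
  have d2 : ∀ᵐ s ∂volume, s ∈ Set.Icc (0:ℝ) 1 → HasDerivAt (fun s => (γ s).2)
      (b s, 2 * (γ s).2.1 * a s - 2 * (γ s).1 * b s) s := by
    filter_upwards [hd] with s hs hI
    exact (hasFDerivAt_snd (𝕜 := ℝ) (p := γ s)).comp_hasDerivAt s (hs hI)
  have dy : ∀ᵐ s ∂volume, s ∈ Set.Icc (0:ℝ) 1 → HasDerivAt (fun s => (γ s).2.1) (b s) s := by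
    filter_upwards [d2] with s hs hI
    exact (hasFDerivAt_fst (𝕜 := ℝ) (p := (γ s).2)).comp_hasDerivAt s (hs hI)
  have dt : ∀ᵐ s ∂volume, s ∈ Set.Icc (0:ℝ) 1 → HasDerivAt (fun s => (γ s).2.2)
      (2 * (γ s).2.1 * a s - 2 * (γ s).1 * b s) s := by
    filter_upwards [d2] with s hs hI
    exact (hasFDerivAt_snd (𝕜 := ℝ) (p := (γ s).2)).comp_hasDerivAt s (hs hI)
  have L0 : 0 ≤ L := by
    rw [hLe]
    exact intervalIntegral.integral_nonneg zero_le_one fun s _ => Real.sqrt_nonneg _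
  have bx : ∀ s ∈ Set.Icc (0:ℝ) 1, |(γ s).1 - 1| ≤ L := by
    intro s hs
    have := lip_bound lx dx (fun s _ => abs_le_speed_left (a s) (b s)) hi hs
    simpa [h0, ← hLe] using this
  have bY : ∀ s ∈ Set.Icc (0:ℝ) 1, |(γ s).2.1| ≤ L := by
    intro s hs
    have := lip_bound ly dy (fun s _ => abs_le_speed_right (a s) (b s)) hi hs
    simpa [h0, ← hLe] using this
  have lτ := lt.add (ly.add ly)
  have dτ : ∀ᵐ s ∂volume, s ∈ Set.Icc (0:ℝ) 1 →
      HasDerivAt (fun s => (γ s).2.2 + ((γ s).2.1 + (γ s).2.1))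
      ((2 * (γ s).2.1 * a s - 2 * (γ s).1 * b s) + (b s + b s)) s := by
    filter_upwards [dt, dy] with s hs hs' hI
    exact (hs hI).add ((hs' hI).add (hs' hI))
  have hbτ : ∀ s ∈ Set.Icc (0:ℝ) 1,
      |(2 * (γ s).2.1 * a s - 2 * (γ s).1 * b s) + (b s + b s)| ≤
        (4 * L) * Real.sqrt (a s ^ 2 + b s ^ 2) := by
    intro s hs
    have e : (2 * (γ s).2.1 * a s - 2 * (γ s).1 * b s) + (b s + b s)
      = 2 * ((γ s).2.1 * a s - ((γ s).1 - 1) * b s) := by ring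
    rw [e, abs_mul, abs_two]
    have h3 := abs_sub ((γ s).2.1 * a s) (((γ s).1 - 1) * b s)
    rw [abs_mul, abs_mul] at h3
    have h4 := mul_le_mul (bY s hs) (abs_le_speed_left (a s) (b s)) (abs_nonneg _) L0
    have h5 := mul_le_mul (bx s hs) (abs_le_speed_right (a s) (b s)) (abs_nonneg _) L0
    linarith
  have key := lip_bound lτ dτ hbτ (hi.const_mul _) I1
  rw [intervalIntegral.integral_const_mul, ← hLe] at key
  simp only [h0, h1] at key
  have k2 := bx 1 I1
  rw [h1] at k2
  refine ⟨L0, ?_, ?_⟩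
  · have := (abs_le.1 k2).1
    simp only at this
    linarith
  · have := (abs_le.1 key).2
    nlinarith

lemma upper_mem {c σ r : ℝ} (hr : r * r = σ) (h0r : 0 ≤ r) :
    ∃ L ∈ { L : ℝ | ∃ (γ : ℝ → H) (a b : ℝ → ℝ) (K : NNReal),
    LipschitzWith K γ ∧ γ 0 = (1, 0, 0) ∧ γ 1 = (1 + c, σ, 0) ∧
    (∀ᵐ s ∂volume, s ∈ Set.Icc (0:ℝ) 1 →
      HasDerivAt γ (a s, b s, 2 * (γ s).2.1 * a s - 2 * (γ s).1 * b s) s) ∧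
    IntervalIntegrable (fun s => Real.sqrt (a s ^ 2 + b s ^ 2)) volume 0 1 ∧
    L = ∫ s in (0:ℝ)..1, Real.sqrt (a s ^ 2 + b s ^ 2) },
    L ≤ |c| + 16 * r + 6 * σ := by
  obtain ⟨m, hm⟩ : ∃ m, m = 15 * r + 5 * σ := ⟨_, rfl⟩
  have hσ0 : 0 ≤ σ := by nlinarith
  let u : ℝ → ℝ := fun s => (c + r) * s - r * s ^ 2
  let v : ℝ → ℝ := fun s => (σ + m) * s - 3 * m * s ^ 2 + 2 * m * s ^ 3
  let w : ℝ → ℝ := fun s => 2 * ((3 * m * (c + r) - r * (σ + m)) / 3 * s ^ 3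
    - m * (c + r) * s ^ 4 + 2 * m * r / 5 * s ^ 5) - 2 * v s
  let a : ℝ → ℝ := fun s => (c + r) - 2 * r * s
  let b : ℝ → ℝ := fun s => (σ + m) - 6 * m * s + 6 * m * s ^ 2
  let Γ : ℝ → H := fun s => (1 + u s, v s, w s)
  have hΓ : ContDiff ℝ 1 Γ := by
    simp only [Γ, u, v, w]
    fun_prop
  have du : ∀ s, HasDerivAt (fun s => 1 + u s) (a s) s := by
    intro s
    have := ((((hasDerivAt_id s).const_mul (c + r)).sub
      ((hasDerivAt_pow 2 s).const_mul r)).const_add 1)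
    refine this.congr_deriv ?_
    simp [a]
    try ring
  have dv : ∀ s, HasDerivAt v (b s) s := by
    intro s
    have := (((hasDerivAt_id s).const_mul (σ + m)).sub
      ((hasDerivAt_pow 2 s).const_mul (3 * m))).add ((hasDerivAt_pow 3 s).const_mul (2 * m))
    refine this.congr_deriv ?_
    simp [b]
    try ring
  have dw : ∀ s, HasDerivAt w (2 * v s * a s - 2 * (1 + u s) * b s) s := by
    intro s
    have := ((((hasDerivAt_pow 3 s).const_mul ((3 * m * (c + r) - r * (σ + m)) / 3)).sub
      ((hasDerivAt_pow 4 s).const_mul (m * (c + r)))).add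
      ((hasDerivAt_pow 5 s).const_mul (2 * m * r / 5))).const_mul 2 |>.sub ((dv s).const_mul 2)
    refine this.congr_deriv ?_
    simp [a, b, u, v]
    try ring
  have dΓ : ∀ s, HasDerivAt Γ (a s, b s, 2 * (Γ s).2.1 * a s - 2 * (Γ s).1 * b s) s :=
    fun s => (du s).prodMk ((dv s).prodMk (dw s))
  obtain ⟨K, hK⟩ : ∃ K, LipschitzOnWith K Γ (Set.Icc 0 1) :=
    (hΓ.locallyLipschitz.locallyLipschitzOn).exists_lipschitzOnWith_of_compact isCompact_Icc
  have hK' := (lipschitzOnWith_iff_restrict.1 hK).comp (LipschitzWith.projIcc (zero_le_one (α := ℝ)))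
  have hcont : Continuous (fun s => Real.sqrt (a s ^ 2 + b s ^ 2)) := by
    simp only [a, b]; fun_prop
  have hmem : (∫ s in (0:ℝ)..1, Real.sqrt (a s ^ 2 + b s ^ 2)) ∈
    { L : ℝ | ∃ (γ : ℝ → H) (a b : ℝ → ℝ) (K : NNReal),
    LipschitzWith K γ ∧ γ 0 = (1, 0, 0) ∧ γ 1 = (1 + c, σ, 0) ∧
    (∀ᵐ s ∂volume, s ∈ Set.Icc (0:ℝ) 1 →
      HasDerivAt γ (a s, b s, 2 * (γ s).2.1 * a s - 2 * (γ s).1 * b s) s) ∧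
    IntervalIntegrable (fun s => Real.sqrt (a s ^ 2 + b s ^ 2)) volume 0 1 ∧
    L = ∫ s in (0:ℝ)..1, Real.sqrt (a s ^ 2 + b s ^ 2) } := by
    refine ⟨_, a, b, _, hK', ?_, ?_, ?_, hcont.intervalIntegrable _ _, rfl⟩
    · simp [Γ, u, v, w]
    · simp only [Function.comp_apply, Set.projIcc_right, Set.domRestrict_apply, Γ, u, v, w,
        Prod.mk.injEq]
      refine ⟨by ring, by ring, ?_⟩
      rw [hm, ← hr]; ring
    · have n0 : ∀ᵐ s : ℝ ∂volume, s ≠ 0 := by simp [ae_iff]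
      have n1 : ∀ᵐ s : ℝ ∂volume, s ≠ 1 := by simp [ae_iff]
      filter_upwards [n0, n1] with s h0 h1 hs
      have hs' : s ∈ Set.Ioo (0:ℝ) 1 := ⟨lt_of_le_of_ne hs.1 (Ne.symm h0), lt_of_le_of_ne hs.2 h1⟩
      have e : ∀ x ∈ Set.Icc (0:ℝ) 1,
          ((Set.Icc (0:ℝ) 1).domRestrict Γ ∘ Set.projIcc 0 1 zero_le_one) x = Γ x := by
        intro x hx
        simp [Set.projIcc_of_mem zero_le_one hx]
      rw [e s hs]
      refine (dΓ s).congr_of_eventuallyEq ?_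
      filter_upwards [isOpen_Ioo.mem_nhds hs'] with x hx
      exact e x ⟨hx.1.le, hx.2.le⟩
  refine ⟨_, hmem, ?_⟩
  have : (∫ s in (0:ℝ)..1, Real.sqrt (a s ^ 2 + b s ^ 2)) ≤
      ∫ s in (0:ℝ)..1, (|c| + 16 * r + 6 * σ) := by
    refine intervalIntegral.integral_mono_on zero_le_one (hcont.intervalIntegrable _ _)
      (continuous_const.intervalIntegrable _ _) fun s hs => ?_
    refine (speed_le _ _).trans ?_
    have hm0 : 0 ≤ m := by rw [hm]; positivity
    have p1 : 0 ≤ s * (1 - s) := mul_nonneg hs.1 (by linarith [hs.2])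
    have p2 : s * (1 - s) ≤ 1 / 4 := by nlinarith [sq_nonneg (s - 1 / 2)]
    have ha : |a s| ≤ |c| + r := by
      have : a s = c + r * (1 - 2 * s) := by simp only [a]; ring
      rw [this, abs_le]
      have q1 := mul_nonneg h0r hs.1
      have q2 := mul_nonneg h0r (sub_nonneg.2 hs.2)
      constructor <;> nlinarith [neg_abs_le c, le_abs_self c]
    have hb : |b s| ≤ σ + m := by
      have : b s = σ + m - 6 * (m * (s * (1 - s))) := by simp only [b]; ring
      rw [this, abs_le]
      have q1 := mul_nonneg hm0 p1
      have q2 := mul_le_mul_of_nonneg_left p2 hm0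
      constructor <;> linarith
    rw [hm] at hb
    linarith
  simpa using this

lemma upper_aux {c σ r : ℝ} (hr : r * r = σ) (h0r : 0 ≤ r) :
    dH (1, 0, 0) (1 + c, σ, 0) ≤ |c| + 16 * r + 6 * σ := by
  obtain ⟨L, hmem, hL⟩ := upper_mem (c := c) hr h0r
  refine le_trans (csInf_le ⟨0, ?_⟩ hmem) hL
  rintro L ⟨γ, a, b, K, -, -, -, -, -, rfl⟩
  exact intervalIntegral.integral_nonneg zero_le_one fun s _ => Real.sqrt_nonneg _

/-- two-sided square-root bounds for `ρ`.
There are constants `C₀ ≥ C₁ > 0` with `C₁√θ ≤ ρ(θ) ≤ C₀√θ` on `[0,π]`. -/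
theorem statement14 :
    ∃ C₀ C₁ : ℝ, 0 < C₁ ∧ C₁ ≤ C₀ ∧
      ∀ θ ∈ Set.Icc (0:ℝ) Real.pi,
        C₁ * Real.sqrt θ ≤ rho θ ∧ rho θ ≤ C₀ * Real.sqrt θ := by
  refine ⟨24, 1 / 2, by norm_num, by norm_num, ?_⟩
  rintro θ ⟨hθ0, hθπ⟩
  have hs0 : 0 ≤ Real.sin θ := Real.sin_nonneg_of_nonneg_of_le_pi hθ0 hθπ
  have hup : rho θ ≤ |Real.cos θ - 1| + 16 * Real.sqrt (Real.sin θ) + 6 * Real.sin θ := by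
    have := upper_aux (c := Real.cos θ - 1) (Real.mul_self_sqrt hs0) (Real.sqrt_nonneg _)
    simpa [rho] using this
  have hne : { L : ℝ | ∃ (γ : ℝ → H) (a b : ℝ → ℝ) (K : NNReal),
    LipschitzWith K γ ∧ γ 0 = (1, 0, 0) ∧ γ 1 = (Real.cos θ, Real.sin θ, 0) ∧
    (∀ᵐ s ∂volume, s ∈ Set.Icc (0:ℝ) 1 →
      HasDerivAt γ (a s, b s, 2 * (γ s).2.1 * a s - 2 * (γ s).1 * b s) s) ∧
    IntervalIntegrable (fun s => Real.sqrt (a s ^ 2 + b s ^ 2)) volume 0 1 ∧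
    L = ∫ s in (0:ℝ)..1, Real.sqrt (a s ^ 2 + b s ^ 2) }.Nonempty := by
    have := upper_mem (c := Real.cos θ - 1) (Real.mul_self_sqrt hs0) (Real.sqrt_nonneg _)
    obtain ⟨L, hL, -⟩ := this
    refine ⟨L, ?_⟩
    simpa only [add_sub_cancel] using hL
  constructor
  · refine le_csInf hne ?_
    rintro L ⟨γ, a, b, K, h1, h2, h3, h4, h5, h6⟩
    obtain ⟨k0, k1, k2⟩ := lower_aux γ a b K h1 h2 h3 h4 h5 h6
    have hsq : θ / 4 ≤ L ^ 2 := by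
      rcases le_total θ (Real.pi / 2) with h | h
      · have := Real.mul_le_sin hθ0 h
        have hp : 1 / 4 ≤ 1 / Real.pi :=
          one_div_le_one_div_of_le Real.pi_pos Real.pi_le_four
        have h8 : 2 / Real.pi * θ = 2 * (1 / Real.pi * θ) := by ring
        nlinarith [mul_le_mul_of_nonneg_right hp hθ0]
      · have := Real.cos_nonpos_of_pi_div_two_le_of_le h (by linarith [Real.pi_pos])
        nlinarith [Real.pi_le_four]
    have := Real.sqrt_nonneg θ
    refine abs_le_of_sq_le_sq' ?_ k0 |>.2
    rw [mul_pow, Real.sq_sqrt hθ0]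
    linarith
  · have hq0 := Real.sqrt_nonneg θ
    have hq := Real.sq_sqrt hθ0
    have h1 : Real.sqrt (Real.sin θ) ≤ Real.sqrt θ := Real.sqrt_le_sqrt (Real.sin_le hθ0)
    have h2 : Real.sin θ ≤ Real.sqrt (Real.sin θ) :=
      Real.le_sqrt_of_sq_le (by nlinarith [Real.sin_le_one θ])
    have h3 : |Real.cos θ - 1| ≤ 2 * Real.sqrt θ := by
      rw [abs_sub_comm, abs_of_nonneg (by linarith [Real.cos_le_one θ])]
      rcases le_total θ 1 with h | h
      · have := Real.one_sub_sq_div_two_le_cos (x := θ)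
        have h5 : θ ≤ Real.sqrt θ := Real.le_sqrt_of_sq_le (by nlinarith)
        nlinarith
      · have : 1 ≤ Real.sqrt θ := Real.one_le_sqrt.2 h
        linarith [Real.neg_one_le_cos θ]
    linarith
end
end
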